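/- Let (v,p) be a smooth axisymmetric solution with no swirl of the steady Navier–Stokes equations on the periodic slab domain D × S¹, satisfying the generalized Dirichlet integral condition with exponent q = 2. Then lim_{r→∞} r^{3/2} sup_{z ∈ [-π,π]} |Ω(r,z)| = 0. -/

import Mathlib

open MeasureTheory Real Set Filter Topology

noncomputable section

/-- Three-dimensional Euclidean space. -/
abbrev E3 := EuclideanSpace ℝ (Fin 3)

/-- The distance to the `x₃`-axis, `r = √(x₁² + x₂²)`. -/
def rr (x : E3) : ℝ := Real.sqrt ((x 0) ^ 2 + (x 1) ^ 2)

/-- Partial derivative of `g : ℝ³ → ℝ` in the `i`-th coordinate direction. -/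
def pd (i : Fin 3) (g : E3 → ℝ) (x : E3) : ℝ := fderiv ℝ g x (EuclideanSpace.single i 1)

/-- Partial derivative in the first (radial) variable of a function of `(r,z)`. -/
def dr (f : ℝ → ℝ → ℝ) (r z : ℝ) : ℝ := deriv (fun s => f s z) r

/-- Partial derivative in the second (vertical) variable of a function of `(r,z)`. -/
def dzz (f : ℝ → ℝ → ℝ) (r z : ℝ) : ℝ := deriv (fun t => f r t) z

/-- The azimuthal vorticity `ω^θ = ∂_z v^r − ∂_r v^z` of an axisymmetric vector
field without swirl, as a function of `(r,z)`. -/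
def omTheta (vr vz : ℝ → ℝ → ℝ) (r z : ℝ) : ℝ := dzz vr r z - dr vz r z

/-- The rescaled azimuthal vorticity `Ω = ω^θ / r`. -/
def Om (vr vz : ℝ → ℝ → ℝ) (r z : ℝ) : ℝ := omTheta vr vz r z / r

/-- The squared Frobenius norm `|∇v|² = ∑ᵢⱼ (∂ᵢ vⱼ)²` of the gradient of a
vector field `v : ℝ³ → ℝ³`. -/
def gradSq3 (v : E3 → E3) (x : E3) : ℝ := ∑ i, ∑ j, (pd i (fun y => v y j) x) ^ 2

/-- `v, p, vr, vz` constitute a smooth axisymmetric solution, without swirl, of the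
steady Navier–Stokes equations in the periodic (in `x₃`, with period `2π`) slab
domain `D × S¹`, where `D = {(x₁,x₂) : √(x₁²+x₂²) > r₀}`; the functions `vr, vz`
of `(r,z)` are the cylindrical components of `v`. -/
structure AxisymNoSwirlNSSlab (r₀ : ℝ) (v : E3 → E3) (p : E3 → ℝ)
    (vr vz : ℝ → ℝ → ℝ) : Prop where
  smooth_v : ContDiffOn ℝ (⊤ : ℕ∞) v {x : E3 | r₀ < rr x}
  smooth_p : ContDiffOn ℝ (⊤ : ℕ∞) p {x : E3 | r₀ < rr x}
  periodic : ∀ x : E3, v (x + (2 * π) • EuclideanSpace.single (2 : Fin 3) (1 : ℝ)) = v x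
  axisym_no_swirl : ∀ x : E3, r₀ < rr x →
    v x 0 = vr (rr x) (x 2) * (x 0 / rr x) ∧
    v x 1 = vr (rr x) (x 2) * (x 1 / rr x) ∧
    v x 2 = vz (rr x) (x 2)
  momentum : ∀ x : E3, r₀ < rr x → ∀ j : Fin 3,
    (∑ i, v x i * pd i (fun y => v y j) x) + pd j p x
      = ∑ i, pd i (pd i (fun y => v y j)) x
  incompressible : ∀ x : E3, r₀ < rr x → (∑ i, pd i (fun y => v y i) x) = 0

/-- The open half plane `{(r, z) : a < r}`. -/
def halfPlane (a : ℝ) : Set (ℝ × ℝ) := {q | a < q.1}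

/-- Smoothness on the open half plane `{(r, z) : a < r}`. -/
def SmoothHalf (a : ℝ) (f : ℝ × ℝ → ℝ) : Prop := ContDiffOn ℝ (⊤ : ℕ∞) f (halfPlane a)

/-- `2π`-periodicity in the second variable. -/
def PeriodicZ (f : ℝ × ℝ → ℝ) : Prop := ∀ q : ℝ × ℝ, f (q + (0, 2 * π)) = f q

/-- Radial partial derivative. -/
def Dr (f : ℝ × ℝ → ℝ) (q : ℝ × ℝ) : ℝ := fderiv ℝ f q (1, 0)

/-- Vertical partial derivative. -/
def Dz (f : ℝ × ℝ → ℝ) (q : ℝ × ℝ) : ℝ := fderiv ℝ f q (0, 1)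

/-- Integral over one vertical period, as a function of the radius. -/
def zInt (f : ℝ × ℝ → ℝ) (r : ℝ) : ℝ := ∫ z in (-π)..π, f (r, z)

lemma isOpen_halfPlane (a : ℝ) : IsOpen (halfPlane a) := isOpen_lt continuous_const continuous_fst

lemma halfPlane_mem_nhds {a : ℝ} {q : ℝ × ℝ} (hq : a < q.1) : halfPlane a ∈ 𝓝 q :=
  (isOpen_halfPlane a).mem_nhds hq

namespace SmoothHalf

variable {a : ℝ} {f g : ℝ × ℝ → ℝ}

lemma contDiffAt (hf : SmoothHalf a f) {q : ℝ × ℝ} (hq : a < q.1) :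
    ContDiffAt ℝ (⊤ : ℕ∞) f q :=
  ContDiffOn.contDiffAt hf (halfPlane_mem_nhds hq)

lemma differentiableAt (hf : SmoothHalf a f) {q : ℝ × ℝ} (hq : a < q.1) :
    DifferentiableAt ℝ f q :=
  (hf.contDiffAt hq).differentiableAt (by simp)

lemma fderiv_apply (hf : SmoothHalf a f) (w : ℝ × ℝ) :
    SmoothHalf a (fun q => fderiv ℝ f q w) := by
  have h : ContDiffOn ℝ (⊤ : ℕ∞) (fderiv ℝ f) (halfPlane a) :=
    ContDiffOn.fderiv_of_isOpen hf (isOpen_halfPlane a) (by simp)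
  exact h.clm_apply contDiffOn_const

lemma dr (hf : SmoothHalf a f) : SmoothHalf a (Dr f) := hf.fderiv_apply _

lemma dz (hf : SmoothHalf a f) : SmoothHalf a (Dz f) := hf.fderiv_apply _

lemma add (hf : SmoothHalf a f) (hg : SmoothHalf a g) : SmoothHalf a (fun q => f q + g q) :=
  ContDiffOn.add hf hg

lemma sub (hf : SmoothHalf a f) (hg : SmoothHalf a g) : SmoothHalf a (fun q => f q - g q) :=
  ContDiffOn.sub hf hg

lemma mul (hf : SmoothHalf a f) (hg : SmoothHalf a g) : SmoothHalf a (fun q => f q * g q) :=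
  ContDiffOn.mul hf hg

lemma pow (hf : SmoothHalf a f) (n : ℕ) : SmoothHalf a (fun q => f q ^ n) :=
  ContDiffOn.pow hf n

lemma const (c : ℝ) : SmoothHalf a (fun _ => c) := contDiffOn_const

lemma fst : SmoothHalf a (fun q => q.1) := contDiffOn_fst

lemma div_fst (ha : 0 < a) (hf : SmoothHalf a f) : SmoothHalf a (fun q => f q / q.1) :=
  ContDiffOn.div hf contDiffOn_fst fun _ hq => (ha.trans hq).ne'

lemma hasDerivAt_dr (hf : SmoothHalf a f) {r : ℝ} (hr : a < r) (z : ℝ) :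
    HasDerivAt (fun s => f (s, z)) (Dr f (r, z)) r :=
  (hf.differentiableAt (q := (r, z)) hr).hasFDerivAt.comp_hasDerivAt r
    ((hasDerivAt_id r).prodMk (hasDerivAt_const r z))

lemma hasDerivAt_dz (hf : SmoothHalf a f) {r : ℝ} (hr : a < r) (z : ℝ) :
    HasDerivAt (fun t => f (r, t)) (Dz f (r, z)) z :=
  (hf.differentiableAt (q := (r, z)) hr).hasFDerivAt.comp_hasDerivAt z
    ((hasDerivAt_const z r).prodMk (hasDerivAt_id z))

lemma dr_eq (hf : SmoothHalf a f) {r z d : ℝ} (hr : a < r)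
    (h : HasDerivAt (fun s => f (s, z)) d r) : Dr f (r, z) = d :=
  (hf.hasDerivAt_dr hr z).unique h

lemma dz_eq (hf : SmoothHalf a f) {r z d : ℝ} (hr : a < r)
    (h : HasDerivAt (fun t => f (r, t)) d z) : Dz f (r, z) = d :=
  (hf.hasDerivAt_dz hr z).unique h

lemma dr_dz_comm (hf : SmoothHalf a f) {q : ℝ × ℝ} (hq : a < q.1) :
    Dr (Dz f) q = Dz (Dr f) q := by
  have hs := (hf.contDiffAt hq).isSymmSndFDerivAt (by
    rw [minSmoothness_of_isRCLikeNormedField]; exact WithTop.coe_le_coe.2 (le_top (a := (2 : ℕ∞))))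
  have hd : DifferentiableAt ℝ (fderiv ℝ f) q :=
    ((hf.contDiffAt hq).fderiv_right (m := (⊤ : ℕ∞)) (by simp)).differentiableAt (by simp)
  have key (w w' : ℝ × ℝ) :
      fderiv ℝ (fun y => fderiv ℝ f y w) q w' = fderiv ℝ (fderiv ℝ f) q w' w := by
    rw [(hd.hasFDerivAt.clm_apply (hasFDerivAt_const w q)).fderiv]
    simp
  change fderiv ℝ (fun y => fderiv ℝ f y (0, 1)) q (1, 0) =
    fderiv ℝ (fun y => fderiv ℝ f y (1, 0)) q (0, 1)
  rw [key, key, hs]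

lemma continuous_slice (hf : SmoothHalf a f) {r : ℝ} (hr : a < r) :
    Continuous fun z => f (r, z) :=
  continuous_iff_continuousAt.2 fun z => (hf.hasDerivAt_dz hr z).continuousAt

lemma intervalIntegrable (hf : SmoothHalf a f) {r : ℝ} (hr : a < r) (c d : ℝ) :
    IntervalIntegrable (fun z => f (r, z)) volume c d :=
  (hf.continuous_slice hr).intervalIntegrable _ _

lemma hasDerivAt_zInt (hf : SmoothHalf a f) {r : ℝ} (hr : a < r) :
    HasDerivAt (zInt f) (zInt (Dr f) r) r := by
  obtain ⟨b, hab, hbr⟩ := exists_between hr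
  have hK : IsCompact (Icc b (r + 1) ×ˢ Icc (-π) π : Set (ℝ × ℝ)) :=
    isCompact_Icc.prod isCompact_Icc
  have hKs : (Icc b (r + 1) ×ˢ Icc (-π) π : Set (ℝ × ℝ)) ⊆ halfPlane a := fun q hq =>
    hab.trans_le hq.1.1
  obtain ⟨C, hC⟩ := hK.exists_bound_of_continuousOn (ContDiffOn.continuousOn hf.dr |>.mono hKs)
  have hπ : -π ≤ π := by linarith [pi_pos]
  refine (intervalIntegral.hasDerivAt_integral_of_dominated_loc_of_deriv_le
    (F := fun s z => f (s, z)) (F' := fun s z => Dr f (s, z)) (bound := fun _ => C)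
    (s := Ioo b (r + 1)) (Ioo_mem_nhds hbr (by linarith)) ?_ ?_ ?_ ?_ ?_ ?_).2
  · filter_upwards [Ioi_mem_nhds hr] with s hs
    exact (hf.continuous_slice hs).aestronglyMeasurable
  · exact hf.intervalIntegrable hr _ _
  · exact (hf.dr.continuous_slice hr).aestronglyMeasurable
  · refine Eventually.of_forall fun z hz s hs => ?_
    rw [uIoc_of_le hπ] at hz
    exact hC (s, z) ⟨Ioo_subset_Icc_self hs, Ioc_subset_Icc_self hz⟩
  · exact intervalIntegrable_const
  · exact Eventually.of_forall fun z _ s hs => hf.hasDerivAt_dr (hab.trans hs.1) z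

lemma continuousOn_zInt (hf : SmoothHalf a f) : ContinuousOn (zInt f) (Ioi a) := fun _ hr =>
  (hf.hasDerivAt_zInt hr).continuousAt.continuousWithinAt

lemma zInt_dz (hf : SmoothHalf a f) (hp : PeriodicZ f) {r : ℝ} (hr : a < r) :
    zInt (Dz f) r = 0 := by
  rw [zInt, intervalIntegral.integral_eq_sub_of_hasDerivAt
    (fun z _ => hf.hasDerivAt_dz hr z) (hf.dz.intervalIntegrable hr _ _)]
  have h := hp (r, -π)
  simp only [Prod.mk_add_mk, add_zero] at h
  rw [show -π + 2 * π = π by ring] at h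
  rw [h, sub_self]

end SmoothHalf

namespace PeriodicZ

variable {f g : ℝ × ℝ → ℝ}

lemma fderiv_apply (hf : PeriodicZ f) (w : ℝ × ℝ) : PeriodicZ (fun q => fderiv ℝ f q w) := by
  intro q
  have h : (fun x => f (x + (0, 2 * π))) = f := funext hf
  have h2 := fderiv_comp_add_right (𝕜 := ℝ) (f := f) (x := q) (0, 2 * π)
  rw [h] at h2
  simp only [h2]

lemma dr (hf : PeriodicZ f) : PeriodicZ (Dr f) := hf.fderiv_apply _

lemma dz (hf : PeriodicZ f) : PeriodicZ (Dz f) := hf.fderiv_apply _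

end PeriodicZ

lemma exists_mem_Icc_periodicZ_eq (r z : ℝ) :
    ∃ z' ∈ Icc (-π) π, ∀ g : ℝ × ℝ → ℝ, PeriodicZ g → g (r, z') = g (r, z) := by
  obtain ⟨n, hn, -⟩ := existsUnique_add_zsmul_mem_Ico (two_pi_pos) z (-π)
  refine ⟨z + n • (2 * π), ⟨hn.1, by have := hn.2; linarith⟩, fun g hg => ?_⟩
  have hper : Function.Periodic (fun t => g (r, t)) (2 * π) := fun t => by
    simpa using hg (r, t)
  exact hper.zsmul n z

/-- The steady axisymmetric Navier–Stokes system without swirl, in the coordinates `(r, z)`. -/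
structure MeridionalNS (a : ℝ) (U W P : ℝ × ℝ → ℝ) : Prop where
  pos : 0 < a
  smooth_U : SmoothHalf a U
  smooth_W : SmoothHalf a W
  smooth_P : SmoothHalf a P
  periodic_U : PeriodicZ U
  periodic_W : PeriodicZ W
  momentum_r : ∀ q : ℝ × ℝ, a < q.1 → U q * Dr U q + W q * Dz U q + Dr P q =
    Dr (Dr U) q + Dz (Dz U) q + (Dr U q / q.1 - U q / q.1 ^ 2)
  momentum_z : ∀ q : ℝ × ℝ, a < q.1 → U q * Dr W q + W q * Dz W q + Dz P q =
    Dr (Dr W) q + Dz (Dz W) q + Dr W q / q.1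
  incompressible : ∀ q : ℝ × ℝ, a < q.1 → Dr U q + Dz W q + U q / q.1 = 0

/-- The rescaled azimuthal vorticity in the coordinates `(r, z)`. -/
def vort (U W : ℝ × ℝ → ℝ) (q : ℝ × ℝ) : ℝ := (Dz U q - Dr W q) / q.1

lemma Dr_congr {a : ℝ} {f g : ℝ × ℝ → ℝ} (h : ∀ q : ℝ × ℝ, a < q.1 → f q = g q) {q : ℝ × ℝ}
    (hq : a < q.1) : Dr f q = Dr g q := by
  have : f =ᶠ[𝓝 q] g := by
    filter_upwards [halfPlane_mem_nhds hq] with x hx using h x hx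
  rw [Dr, Dr, this.fderiv_eq]

lemma Dz_congr {a : ℝ} {f g : ℝ × ℝ → ℝ} (h : ∀ q : ℝ × ℝ, a < q.1 → f q = g q) {q : ℝ × ℝ}
    (hq : a < q.1) : Dz f q = Dz g q := by
  have : f =ᶠ[𝓝 q] g := by
    filter_upwards [halfPlane_mem_nhds hq] with x hx using h x hx
  rw [Dz, Dz, this.fderiv_eq]

namespace MeridionalNS

variable {a : ℝ} {U W P : ℝ × ℝ → ℝ}

lemma smooth_vort (h : MeridionalNS a U W P) : SmoothHalf a (vort U W) :=
  (h.smooth_U.dz.sub h.smooth_W.dr).div_fst h.pos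

lemma periodic_vort (h : MeridionalNS a U W P) : PeriodicZ (vort U W) := fun q => by
  simp [vort, h.periodic_U.dz q, h.periodic_W.dr q]

/-- The equation of the azimuthal vorticity `ω = ∂_z U - ∂_r W`, obtained by taking the curl of
the momentum equations. -/
lemma curl_momentum (h : MeridionalNS a U W P) {q : ℝ × ℝ} (hq : a < q.1) :
    U q * (Dz (Dr U) q - Dr (Dr W) q) + W q * (Dz (Dz U) q - Dz (Dr W) q) =
      (Dr (Dr (Dz U)) q - Dr (Dr (Dr W)) q) + (Dz (Dz (Dz U)) q - Dz (Dz (Dr W)) q) +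
      (Dz (Dr U) q - Dr (Dr W) q) / q.1 - (Dz U q - Dr W q) / q.1 ^ 2 +
      U q / q.1 * (Dz U q - Dr W q) := by
  obtain ⟨r, z⟩ := q
  have hr : a < r := hq
  have hr0 : r ≠ 0 := (h.pos.trans hr).ne'
  have hU := h.smooth_U
  have hW := h.smooth_W
  have hP := h.smooth_P
  have e1 := (((hU.hasDerivAt_dz hr z).mul (hU.dr.hasDerivAt_dz hr z)).add
    ((hW.hasDerivAt_dz hr z).mul (hU.dz.hasDerivAt_dz hr z))).add (hP.dr.hasDerivAt_dz hr z)
  have e2 := ((hU.dr.dr.hasDerivAt_dz hr z).add (hU.dz.dz.hasDerivAt_dz hr z)).add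
    (((hU.dr.hasDerivAt_dz hr z).div_const r).sub ((hU.hasDerivAt_dz hr z).div_const (r ^ 2)))
  have e12 := e1.unique (e2.congr_of_eventuallyEq
    (Eventually.of_forall fun t => h.momentum_r (r, t) hr))
  have f1 := (((hU.hasDerivAt_dr hr z).mul (hW.dr.hasDerivAt_dr hr z)).add
    ((hW.hasDerivAt_dr hr z).mul (hW.dz.hasDerivAt_dr hr z))).add (hP.dz.hasDerivAt_dr hr z)
  have f2 := ((hW.dr.dr.hasDerivAt_dr hr z).add (hW.dz.dz.hasDerivAt_dr hr z)).add
    ((hW.dr.hasDerivAt_dr hr z).div (hasDerivAt_id r) hr0)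
  have f12 := f1.unique (f2.congr_of_eventuallyEq (by
    filter_upwards [Ioi_mem_nhds hr] with s hs using h.momentum_z (s, z) hs))
  have c1 : Dz (Dr (Dr U)) (r, z) = Dr (Dr (Dz U)) (r, z) := by
    rw [← hU.dr.dr_dz_comm hr]
    exact Dr_congr (fun x hx => (hU.dr_dz_comm hx).symm) hr
  have c2 : Dr (Dz (Dz W)) (r, z) = Dz (Dz (Dr W)) (r, z) := by
    rw [hW.dz.dr_dz_comm hr]
    exact Dz_congr (fun x hx => hW.dr_dz_comm hx) hr
  have c3 := hP.dr_dz_comm (q := (r, z)) hr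
  have c4 := hU.dr_dz_comm (q := (r, z)) hr
  have c5 := hW.dr_dz_comm (q := (r, z)) hr
  have inc := h.incompressible (r, z) hr
  simp only [id, mul_one] at *
  rw [c1] at e12
  rw [c2, c3, c5] at f12
  have inc' : Dz W (r, z) = - Dr U (r, z) - U (r, z) / r := by linarith
  rw [inc'] at e12 f12
  field_simp at e12 f12 ⊢
  linear_combination e12 - f12

lemma vorticity_equation (h : MeridionalNS a U W P) {q : ℝ × ℝ} (hq : a < q.1) :
    Dr (Dr (vort U W)) q + 3 / q.1 * Dr (vort U W) q + Dz (Dz (vort U W)) q =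
      U q * Dr (vort U W) q + W q * Dz (vort U W) q := by
  have hΩ := h.smooth_vort
  have hU := h.smooth_U
  have hW := h.smooth_W
  have hdef : ∀ x : ℝ × ℝ, a < x.1 → Dz U x - Dr W x = x.1 * vort U W x := fun x hx => by
    have : x.1 ≠ 0 := (h.pos.trans hx).ne'
    simp only [vort]; field_simp
  have r1 : ∀ x : ℝ × ℝ, a < x.1 → Dr (Dz U) x - Dr (Dr W) x =
      vort U W x + x.1 * Dr (vort U W) x := fun x hx => by
    obtain ⟨r, z⟩ := x
    refine ((hU.dz.hasDerivAt_dr hx z).sub (hW.dr.hasDerivAt_dr hx z)).unique ?_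
    refine (((hasDerivAt_id r).mul (hΩ.hasDerivAt_dr hx z)).congr_deriv (by simp)).congr_of_eventuallyEq
      ?_
    filter_upwards [Ioi_mem_nhds hx] with s hs using hdef (s, z) hs
  have r2 : ∀ x : ℝ × ℝ, a < x.1 → Dr (Dr (Dz U)) x - Dr (Dr (Dr W)) x =
      2 * Dr (vort U W) x + x.1 * Dr (Dr (vort U W)) x := fun x hx => by
    obtain ⟨r, z⟩ := x
    refine ((hU.dz.dr.hasDerivAt_dr hx z).sub (hW.dr.dr.hasDerivAt_dr hx z)).unique ?_
    refine (((hΩ.hasDerivAt_dr hx z).add ((hasDerivAt_id r).mul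
      (hΩ.dr.hasDerivAt_dr hx z))).congr_deriv (by simp; ring)).congr_of_eventuallyEq ?_
    filter_upwards [Ioi_mem_nhds hx] with s hs using r1 (s, z) hs
  have z1 : ∀ x : ℝ × ℝ, a < x.1 → Dz (Dz U) x - Dz (Dr W) x = x.1 * Dz (vort U W) x :=
      fun x hx => by
    obtain ⟨r, z⟩ := x
    refine ((hU.dz.hasDerivAt_dz hx z).sub (hW.dr.hasDerivAt_dz hx z)).unique ?_
    exact ((hΩ.hasDerivAt_dz hx z).const_mul r).congr_of_eventuallyEq
      (Eventually.of_forall fun t => hdef (r, t) hx)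
  have z2 : ∀ x : ℝ × ℝ, a < x.1 → Dz (Dz (Dz U)) x - Dz (Dz (Dr W)) x =
      x.1 * Dz (Dz (vort U W)) x := fun x hx => by
    obtain ⟨r, z⟩ := x
    refine ((hU.dz.dz.hasDerivAt_dz hx z).sub (hW.dr.dz.hasDerivAt_dz hx z)).unique ?_
    exact ((hΩ.dz.hasDerivAt_dz hx z).const_mul r).congr_of_eventuallyEq
      (Eventually.of_forall fun t => z1 (r, t) hx)
  have key := h.curl_momentum hq
  have hq0 : q.1 ≠ 0 := (h.pos.trans hq).ne'
  rw [← hU.dr_dz_comm hq, r1 q hq, z1 q hq, r2 q hq, z2 q hq, hdef q hq] at key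
  field_simp at key ⊢
  refine mul_left_cancel₀ hq0 ?_
  linear_combination -key

end MeridionalNS

lemma sq_le_integral_sq_add {f f' : ℝ → ℝ} (hf : ∀ z, HasDerivAt f (f' z) z)
    (hf' : Continuous f') {z : ℝ} (hz : z ∈ Icc (-π) π) :
    f z ^ 2 ≤ (∫ y in (-π)..π, f y ^ 2) + 2 * ∫ y in (-π)..π, |f y * f' y| := by
  have hπ : -π ≤ π := by linarith [pi_pos]
  have hc : Continuous f := continuous_iff_continuousAt.2 fun z => (hf z).continuousAt
  set N := ∫ y in (-π)..π, |f y * f' y| with hN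
  have hN' : ∀ y ∈ Icc (-π) π, f z ^ 2 - 2 * N ≤ f y ^ 2 := by
    intro y hy
    have h1 : ∫ t in y..z, f t * f' t = f z ^ 2 / 2 - f y ^ 2 / 2 :=
      intervalIntegral.integral_eq_sub_of_hasDerivAt
        (fun t _ => (((hf t).pow 2).div_const 2).congr_deriv (by simp; ring))
        ((hc.mul hf').intervalIntegrable _ _)
    have h2 : ∫ t in y..z, f t * f' t ≤ N := by
      refine (le_abs_self _).trans
        ((intervalIntegral.norm_integral_le_integral_norm_uIoc (f := fun t => f t * f' t)).trans ?_)
      rw [hN, intervalIntegral.integral_of_le hπ]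
      refine setIntegral_mono_set ?_ (Eventually.of_forall fun _ => abs_nonneg _)
        (LE.le.eventuallyLE ?_)
      · exact ((hc.mul hf').abs.intervalIntegrable _ _).1
      · exact Ioc_subset_Ioc (le_min hy.1 hz.1) (max_le hy.2 hz.2)
    linarith
  have h3 := intervalIntegral.integral_mono_on hπ intervalIntegrable_const
    (Continuous.intervalIntegrable (μ := volume) (u := fun y => f y ^ 2) (by fun_prop) _ _) hN'
  simp only [intervalIntegral.integral_const, smul_eq_mul] at h3
  have h0 : 0 ≤ ∫ y in (-π)..π, f y ^ 2 :=
    intervalIntegral.integral_nonneg hπ fun _ _ => sq_nonneg _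
  have h4 : 1 ≤ π - -π := by linarith [pi_gt_three]
  by_cases hs : f z ^ 2 - 2 * N ≤ 0
  · linarith
  · nlinarith

/-- A Caccioppoli-type inequality on dyadic shells for a flux identity in one variable. -/
lemma integral_le_of_flux_identity {A A' E B N F : ℝ → ℝ} {C R : ℝ} (hC : 0 ≤ C) (hR : 1 ≤ R)
    (hA : ∀ r ∈ Icc R (4 * R), HasDerivAt A (A' r) r)
    (hF : ∀ r ∈ Icc R (4 * R), HasDerivAt F (2 * r * E r) r)
    (hFe : ∀ r ∈ Icc R (4 * R), F r = r * A' r + 2 * A r - r * B r)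
    (hE : ContinuousOn E (Icc R (4 * R)))
    (hA0 : ∀ r ∈ Icc R (4 * R), 0 ≤ A r) (hE0 : ∀ r ∈ Icc R (4 * R), 0 ≤ E r)
    (hB : ∀ r ∈ Icc R (4 * R), |B r| ≤ C * r * (A r + 2 * N r))
    (hN : ∀ r ∈ Icc R (4 * R), ∀ c d : ℝ, 2 * c * d * N r ≤ c ^ 2 * A r + d ^ 2 * E r) :
    ∫ r in (2 * R)..(3 * R), E r ≤ (90 + 288 * C + 2304 * C ^ 2) * ∫ r in R..(4 * R), A r := by
  set K := 90 + 288 * C + 2304 * C ^ 2 with hK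
  set φ : ℝ → ℝ := fun r => (r - R) * (4 * R - r) with hφ
  have hle : R ≤ 4 * R := by linarith
  have dφ : ∀ r, HasDerivAt φ (5 * R - 2 * r) r := fun r =>
    (((hasDerivAt_id r).sub_const R).mul ((hasDerivAt_id r).const_sub (4 * R))).congr_deriv
      (by simp; ring)
  have cφ : Continuous φ := by fun_prop
  have cA : ContinuousOn A (Icc R (4 * R)) := fun r hr => (hA r hr).continuousAt.continuousWithinAt
  set Ψ : ℝ → ℝ := fun r => F r * φ r ^ 2 - r * A r * (2 * φ r * (5 * R - 2 * r)) with hΨ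
  have dΨ : ∀ r ∈ Icc R (4 * R), HasDerivAt Ψ (2 * r * E r * φ r ^ 2 +
      2 * φ r * (5 * R - 2 * r) * (A r - r * B r) -
      2 * r * A r * ((5 * R - 2 * r) ^ 2 - 2 * φ r)) r := by
    intro r hr
    have h := ((hF r hr).mul ((dφ r).pow 2)).sub (((hasDerivAt_id r).mul (hA r hr)).mul
      (((dφ r).const_mul 2).mul (((hasDerivAt_id r).const_mul 2).const_sub (5 * R))))
    refine h.congr_deriv ?_
    simp only [hFe r hr, id]
    simp
    ring
  have hpt : ∀ r ∈ Icc R (4 * R), r * E r * φ r ^ 2 - K * R ^ 5 * A r ≤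
      2 * r * E r * φ r ^ 2 + 2 * φ r * (5 * R - 2 * r) * (A r - r * B r) -
      2 * r * A r * ((5 * R - 2 * r) ^ 2 - 2 * φ r) := by
    intro r hr
    obtain ⟨h1, h2⟩ := hr
    have hA0 := hA0 r ⟨h1, h2⟩
    have hE0 := hE0 r ⟨h1, h2⟩
    have hB := hB r ⟨h1, h2⟩
    have hN := hN r ⟨h1, h2⟩ (2 * C * r * |5 * R - 2 * r|) (φ r)
    have hφ0 : 0 ≤ φ r := mul_nonneg (by linarith) (by linarith)
    have hφ3 : φ r ≤ 3 * R ^ 2 := by simp only [hφ]; nlinarith [sq_nonneg (2 * r - 5 * R)]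
    have hd : |5 * R - 2 * r| ≤ 3 * R := abs_le.2 ⟨by linarith, by linarith⟩
    set δ := 5 * R - 2 * r
    have hd0 := abs_nonneg δ
    have hr0 : 0 < r := by linarith
    have hRp : 0 < R := by linarith
    have hδ2 : δ ^ 2 ≤ 9 * R ^ 2 := by rw [← sq_abs]; nlinarith
    have hφd : φ r * |δ| ≤ 9 * R ^ 3 := by
      calc φ r * |δ| ≤ (3 * R ^ 2) * (3 * R) := by gcongr
        _ = _ := by ring
    have hR35 : R ^ 3 ≤ R ^ 5 := pow_le_pow_right₀ hR (by norm_num)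
    have t1 : -(18 * R ^ 5 * A r) ≤ 2 * φ r * δ * A r := by
      have : |φ r * δ| ≤ 9 * R ^ 5 := by
        rw [abs_mul, abs_of_nonneg hφ0]; linarith
      have := (abs_le.1 this).1
      nlinarith
    have t2 : 2 * r * A r * δ ^ 2 ≤ 72 * R ^ 5 * A r := by
      have : r * δ ^ 2 ≤ 36 * R ^ 5 := by
        calc r * δ ^ 2 ≤ (4 * R) * (9 * R ^ 2) := by gcongr
          _ = 36 * R ^ 3 := by ring
          _ ≤ _ := by linarith
      nlinarith
    have t3 : 0 ≤ 4 * r * A r * φ r := by positivity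
    have t4 : 2 * φ r * δ * (r * B r) ≤
        (288 * C + 2304 * C ^ 2) * R ^ 5 * A r + r * E r * φ r ^ 2 := by
      have u1 : 2 * φ r * δ * (r * B r) ≤ 2 * φ r * |δ| * (r * |B r|) := by
        have : δ * B r ≤ |δ| * |B r| := by rw [← abs_mul]; exact le_abs_self _
        have := mul_le_mul_of_nonneg_left this (show 0 ≤ 2 * φ r * r by positivity)
        linarith
      have u2 : 2 * φ r * |δ| * (r * |B r|) ≤
          2 * φ r * |δ| * (r * (C * r * (A r + 2 * N r))) := by gcongr
      have u3 : 2 * (φ r * |δ|) * r ^ 2 * C * A r ≤ 288 * C * R ^ 5 * A r := by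
        calc 2 * (φ r * |δ|) * r ^ 2 * C * A r
            ≤ 2 * (9 * R ^ 3) * (4 * R) ^ 2 * C * A r := by gcongr
          _ = _ := by ring
      have u4 : r * (2 * C * r * |δ|) ^ 2 * A r ≤ 2304 * C ^ 2 * R ^ 5 * A r := by
        calc r * (2 * C * r * |δ|) ^ 2 * A r
            ≤ (4 * R) * (2 * C * (4 * R) * (3 * R)) ^ 2 * A r := by gcongr
          _ = _ := by ring
      have u5 := mul_le_mul_of_nonneg_left hN hr0.le
      calc _ ≤ _ := u1
        _ ≤ _ := u2
        _ = 2 * (φ r * |δ|) * r ^ 2 * C * A r + r * (2 * (2 * C * r * |δ|) * φ r * N r) := by ring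
        _ ≤ _ := by linarith
    have hKe : K * R ^ 5 * A r = 18 * R ^ 5 * A r + 72 * R ^ 5 * A r +
        (288 * C + 2304 * C ^ 2) * R ^ 5 * A r := by rw [hK]; ring
    have : 2 * r * E r * φ r ^ 2 + 2 * φ r * δ * (A r - r * B r) -
        2 * r * A r * (δ ^ 2 - 2 * φ r) = 2 * (r * E r * φ r ^ 2) + 2 * φ r * δ * A r -
        2 * φ r * δ * (r * B r) - 2 * r * A r * δ ^ 2 + 4 * r * A r * φ r := by ring
    rw [this, hKe]
    linarith
  have cL : ContinuousOn (fun r => r * E r * φ r ^ 2) (Icc R (4 * R)) :=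
    (continuousOn_id.mul hE).mul (cφ.pow 2).continuousOn
  have iL : IntervalIntegrable (fun r => r * E r * φ r ^ 2) volume R (4 * R) :=
    cL.intervalIntegrable_of_Icc hle
  have iA : IntervalIntegrable A volume R (4 * R) := cA.intervalIntegrable_of_Icc hle
  have hmain : ∫ r in R..(4 * R), (r * E r * φ r ^ 2 - K * R ^ 5 * A r) ≤ Ψ (4 * R) - Ψ R := by
    refine intervalIntegral.integral_le_sub_of_hasDeriv_right_of_le hle
      (fun r hr => (dΨ r hr).continuousAt.continuousWithinAt)
      (fun r hr => (dΨ r (Ioo_subset_Icc_self hr)).hasDerivWithinAt)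
      ((cL.sub (continuousOn_const.mul cA)).integrableOn_Icc)
      (fun r hr => hpt r (Ioo_subset_Icc_self hr))
  have hΨ0 : Ψ (4 * R) - Ψ R = 0 := by simp [hΨ, hφ]
  rw [hΨ0, intervalIntegral.integral_sub iL (iA.const_mul _),
    intervalIntegral.integral_const_mul] at hmain
  have hsub : Icc (2 * R) (3 * R) ⊆ Icc R (4 * R) := Icc_subset_Icc (by linarith) (by linarith)
  have iE : IntervalIntegrable E volume (2 * R) (3 * R) :=
    (hE.mono hsub).intervalIntegrable_of_Icc (by linarith)
  have hmid : ∫ r in (2 * R)..(3 * R), R ^ 5 * E r ≤ ∫ r in R..(4 * R), r * E r * φ r ^ 2 := by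
    calc ∫ r in (2 * R)..(3 * R), R ^ 5 * E r
        ≤ ∫ r in (2 * R)..(3 * R), r * E r * φ r ^ 2 := by
          refine intervalIntegral.integral_mono_on (by linarith) (iE.const_mul _)
            ((cL.mono hsub).intervalIntegrable_of_Icc (by linarith)) fun r hr => ?_
          have hE0 := hE0 r (hsub hr)
          have hRp : 0 < R := by linarith
          have hr0 : 0 < r := by linarith [hr.1]
          have : R ^ 2 ≤ φ r := by simp only [hφ]; nlinarith [hr.1, hr.2]
          calc R ^ 5 * E r = R * E r * (R ^ 2) ^ 2 := by ring
            _ ≤ r * E r * φ r ^ 2 := by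
              gcongr
              linarith [hr.1]
      _ ≤ _ := by
          refine intervalIntegral.integral_mono_interval (by linarith) (by linarith) (by linarith)
            ?_ iL
          filter_upwards [ae_restrict_mem measurableSet_Ioc] with r hr
          have := hE0 r (Ioc_subset_Icc_self hr)
          have : 0 < r := by linarith [hr.1]
          simp only [Pi.zero_apply]; positivity
  rw [intervalIntegral.integral_const_mul] at hmid
  have hR5 : 0 < R ^ 5 := by positivity
  refine le_of_mul_le_mul_left ?_ hR5
  linarith

lemma deriv2_nonpos_of_isLocalMax {f f' : ℝ → ℝ} {f'' x : ℝ} (hmax : IsLocalMax f x)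
    (hf : ∀ᶠ y in 𝓝 x, HasDerivAt f (f' y) y) (hf' : HasDerivAt f' f'' x) : f'' ≤ 0 := by
  by_contra! hpos
  have hd : deriv f =ᶠ[𝓝 x] f' := hf.mono fun y hy => hy.deriv
  have h2 : deriv (deriv f) x = f'' := by rw [hd.deriv_eq, hf'.deriv]
  have hmin : IsLocalMin f x := isLocalMin_of_deriv_deriv_pos (by rw [h2]; exact hpos)
    hmax.deriv_eq_zero hf.self_of_nhds.continuousAt
  have hconst : f =ᶠ[𝓝 x] fun _ => f x := by
    filter_upwards [hmax, hmin] with y h1 h2 using le_antisymm h1 h2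
  have : deriv f =ᶠ[𝓝 x] fun _ => 0 := by
    simpa using hconst.deriv
  have h3 := this.deriv_eq
  rw [h2] at h3
  simp at h3
  linarith

/-- The weak maximum principle on a shell `s₁ ≤ r ≤ s₂` for vertically periodic functions. -/
lemma le_of_elliptic_eq {a s₁ s₂ m : ℝ} {f b w : ℝ × ℝ → ℝ} (ha : a < s₁)
    (hf : SmoothHalf a f) (hfp : PeriodicZ f) (hb : SmoothHalf a b)
    (heq : ∀ q : ℝ × ℝ, a < q.1 →
      Dr (Dr f) q + Dz (Dz f) q = b q * Dr f q + w q * Dz f q)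
    (h₁ : ∀ z, f (s₁, z) ≤ m) (h₂ : ∀ z, f (s₂, z) ≤ m) {r z : ℝ} (hr : r ∈ Icc s₁ s₂) :
    f (r, z) ≤ m := by
  set S : Set (ℝ × ℝ) := Icc s₁ s₂ ×ˢ Icc (-π) π with hS
  have hK : IsCompact S := isCompact_Icc.prod isCompact_Icc
  have hKs : S ⊆ halfPlane a := fun q hq => ha.trans_le hq.1.1
  obtain ⟨C, hC⟩ := hK.exists_bound_of_continuousOn (ContDiffOn.continuousOn hb |>.mono hKs)
  set l := |C| + 1 with hl
  have hl0 : 0 < l := by positivity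
  have key : ∀ ε > 0, f (r, z) ≤ m + ε * exp (l * s₂) := by
    intro ε hε
    set g : ℝ × ℝ → ℝ := fun q => f q + ε * exp (l * q.1) with hg
    have hgp : PeriodicZ g := fun q => by simp [hg, hfp q]
    have hgc : ContinuousOn g S :=
      ((ContDiffOn.continuousOn hf).mono hKs).add (by fun_prop)
    obtain ⟨z₀, hz₀, hper₀⟩ := exists_mem_Icc_periodicZ_eq r z
    obtain ⟨⟨ρ, ζ⟩, hq, hmax⟩ := hK.exists_isMaxOn ⟨(r, z₀), hr, hz₀⟩ hgc
    have hmax' : ∀ s ∈ Icc s₁ s₂, ∀ t, g (s, t) ≤ g (ρ, ζ) := by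
      intro s hs t
      obtain ⟨t', ht', hper⟩ := exists_mem_Icc_periodicZ_eq s t
      rw [← hper g hgp]
      exact hmax ⟨hs, ht'⟩
    have hρ : a < ρ := hKs hq
    have hfin : g (ρ, ζ) ≤ m + ε * exp (l * s₂) := by
      have hexp : exp (l * ρ) ≤ exp (l * s₂) := by
        have := hq.1.2
        gcongr
      have hbd : f (ρ, ζ) ≤ m → g (ρ, ζ) ≤ m + ε * exp (l * s₂) := fun h => by
        simp only [hg]; gcongr
      rcases hq.1.1.eq_or_lt with h | h
      · exact hbd (by simp only at h; rw [← h]; exact h₁ ζ)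
      rcases hq.1.2.eq_or_lt with h' | h'
      · exact hbd (by simp only at h'; rw [h']; exact h₂ ζ)
      exfalso
      simp only at h h'
      have mr : IsLocalMax (fun s => g (s, ζ)) ρ := by
        filter_upwards [Ioo_mem_nhds h h'] with s hs using hmax' s (Ioo_subset_Icc_self hs) ζ
      have mz : IsLocalMax (fun t => g (ρ, t)) ζ :=
        Eventually.of_forall fun t => hmax' ρ hq.1 t
      have de : ∀ s, HasDerivAt (fun s => ε * exp (l * s)) (ε * l * exp (l * s)) s := fun s =>
        ((((hasDerivAt_id s).const_mul l).exp).const_mul ε).congr_deriv (by simp; ring)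
      have de2 : HasDerivAt (fun s => ε * l * exp (l * s)) (ε * l ^ 2 * exp (l * ρ)) ρ :=
        ((((hasDerivAt_id ρ).const_mul l).exp).const_mul (ε * l)).congr_deriv (by simp; ring)
      have gr : ∀ s, a < s → HasDerivAt (fun s => g (s, ζ))
          (Dr f (s, ζ) + ε * l * exp (l * s)) s := fun s hs => (hf.hasDerivAt_dr hs ζ).add (de s)
      have grr := deriv2_nonpos_of_isLocalMax mr
        (by filter_upwards [Ioi_mem_nhds hρ] with s hs using gr s hs)
        ((hf.dr.hasDerivAt_dr hρ ζ).add de2)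
      have gz : ∀ t, HasDerivAt (fun t => g (ρ, t)) (Dz f (ρ, t)) t := fun t =>
        (hf.hasDerivAt_dz hρ t).add_const (ε * exp (l * ρ))
      have gzz := deriv2_nonpos_of_isLocalMax mz (Eventually.of_forall gz)
        (hf.dz.hasDerivAt_dz hρ ζ)
      have gr0 := mr.hasDerivAt_eq_zero (gr ρ hρ)
      have gz0 := mz.hasDerivAt_eq_zero (gz ζ)
      have e := heq (ρ, ζ) hρ
      have hbC : |b (ρ, ζ)| ≤ C := hC _ hq
      have hb1 := (abs_le.1 (hbC.trans (le_abs_self C))).2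
      have hfr : Dr f (ρ, ζ) = -(ε * l * exp (l * ρ)) := by linarith
      rw [gz0, hfr] at e
      have hp : 0 < ε * l * exp (l * ρ) := by positivity
      have : 0 < (l - b (ρ, ζ)) * (ε * l * exp (l * ρ)) := mul_pos (by linarith) hp
      linarith
    have hrz := hmax' r hr z
    have : 0 < ε * exp (l * r) := by positivity
    have : f (r, z) ≤ g (r, z) := by simp only [hg]; linarith
    linarith
  have ht : Tendsto (fun ε : ℝ => m + ε * exp (l * s₂)) (𝓝[>] 0) (𝓝 (m + 0 * exp (l * s₂))) :=
    ((tendsto_id.mono_left nhdsWithin_le_nhds).mul_const _).const_add _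
  rw [zero_mul, add_zero] at ht
  exact ge_of_tendsto ht (eventually_nhdsWithin_of_forall key)

lemma zInt_mono {f g : ℝ × ℝ → ℝ} {r : ℝ} (hf : Continuous fun z => f (r, z))
    (hg : Continuous fun z => g (r, z)) (h : ∀ z, f (r, z) ≤ g (r, z)) :
    zInt f r ≤ zInt g r :=
  intervalIntegral.integral_mono (by linarith [pi_pos]) (hf.intervalIntegrable _ _)
    (hg.intervalIntegrable _ _) h

lemma zInt_nonneg {f : ℝ × ℝ → ℝ} {r : ℝ} (h : ∀ z, 0 ≤ f (r, z)) : 0 ≤ zInt f r :=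
  intervalIntegral.integral_nonneg (by linarith [pi_pos]) fun z _ => h z

lemma zInt_const_mul {f : ℝ × ℝ → ℝ} (c r : ℝ) :
    zInt (fun q => c * f q) r = c * zInt f r := intervalIntegral.integral_const_mul _ _

namespace MeridionalNS

variable {a : ℝ} {U W P : ℝ × ℝ → ℝ}

/-- The flux whose radial derivative is the enstrophy dissipation `2 r |∇Ω|²` up to a vertical
derivative. -/
lemma hasDerivAt_flux (h : MeridionalNS a U W P) {r : ℝ} (hr : a < r) :
    HasDerivAt (zInt fun q => q.1 * (2 * vort U W q * Dr (vort U W) q) + 2 * vort U W q ^ 2 -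
        q.1 * (U q * vort U W q ^ 2))
      (2 * r * zInt (fun q => Dr (vort U W) q ^ 2 + Dz (vort U W) q ^ 2) r) r := by
  have hU := h.smooth_U
  have hW := h.smooth_W
  have hΩ := h.smooth_vort
  set Ω := vort U W with hΩdef
  have hQ : SmoothHalf a (fun q => 2 * Ω q * Dr Ω q) := ((SmoothHalf.const 2).mul hΩ).mul hΩ.dr
  have hΦ := ((SmoothHalf.fst.mul hQ).add ((SmoothHalf.const 2).mul (hΩ.pow 2))).sub
    (SmoothHalf.fst.mul (hU.mul (hΩ.pow 2)))
  have hT : SmoothHalf a fun q => q.1 * (W q * Ω q ^ 2) - q.1 * (2 * Ω q * Dz Ω q) :=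
    (SmoothHalf.fst.mul (hW.mul (hΩ.pow 2))).sub
      (SmoothHalf.fst.mul (((SmoothHalf.const 2).mul hΩ).mul hΩ.dz))
  have hTp : PeriodicZ fun q => q.1 * (W q * Ω q ^ 2) - q.1 * (2 * Ω q * Dz Ω q) := fun q => by
    simp [h.periodic_W q, h.periodic_vort q, h.periodic_vort.dz q, hΩdef]
  have hE : SmoothHalf a fun q => Dr Ω q ^ 2 + Dz Ω q ^ 2 := (hΩ.dr.pow 2).add (hΩ.dz.pow 2)
  refine (hΦ.hasDerivAt_zInt hr).congr_deriv ?_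
  rw [← zInt_const_mul, ← sub_eq_zero, ← hT.zInt_dz hTp hr, zInt, zInt, zInt,
    ← intervalIntegral.integral_sub (hΦ.dr.intervalIntegrable hr _ _)
      (((SmoothHalf.const _).mul hE).intervalIntegrable hr _ _)]
  refine intervalIntegral.integral_congr fun z _ => ?_
  have d1 := (((hasDerivAt_id r).mul (((hΩ.hasDerivAt_dr hr z).const_mul 2).mul
    (hΩ.dr.hasDerivAt_dr hr z))).add (((hΩ.hasDerivAt_dr hr z).pow 2).const_mul 2)).sub
    ((hasDerivAt_id r).mul ((hU.hasDerivAt_dr hr z).mul ((hΩ.hasDerivAt_dr hr z).pow 2)))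
  have d2 := (((hW.hasDerivAt_dz hr z).mul ((hΩ.hasDerivAt_dz hr z).pow 2)).const_mul r).sub
    ((((hΩ.hasDerivAt_dz hr z).const_mul 2).mul (hΩ.dz.hasDerivAt_dz hr z)).const_mul r)
  have e1 := hΦ.dr_eq hr d1
  have e2 := hT.dz_eq hr d2
  rw [e1, e2]
  have v := h.vorticity_equation (q := (r, z)) hr
  have inc := h.incompressible (r, z) hr
  rw [← hΩdef] at v
  have hr0 : r ≠ 0 := (h.pos.trans hr).ne'
  have inc' : Dz W (r, z) = - Dr U (r, z) - U (r, z) / r := by linarith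
  simp only [id] at *
  rw [inc']
  field_simp at v ⊢
  simp
  linear_combination 2 * Ω (r, z) * v

/-- A finite Dirichlet integral forces at most linear growth of the vertical `L²` norm of the
radial velocity. -/
lemma exists_zInt_sq_le (h : MeridionalNS a U W P) {r₁ D : ℝ} (hr₁ : a < r₁)
    (hD : ∀ R ≥ r₁, ∫ s in r₁..R, s * zInt (fun q => Dr U q ^ 2) s ≤ D) :
    ∃ C, 0 ≤ C ∧ ∀ r ≥ r₁, zInt (fun q => U q ^ 2) r ≤ C * r ^ 2 := by
  have hU := h.smooth_U
  have h1 : 0 < r₁ := h.pos.trans hr₁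
  set y := zInt (fun q => U q ^ 2) with hy
  have hD0 : 0 ≤ D := by simpa using hD r₁ le_rfl
  have hy0 : ∀ r, 0 ≤ y r := fun r => zInt_nonneg fun z => sq_nonneg _
  refine ⟨y r₁ / r₁ ^ 2 + D / r₁ ^ 2, by have := hy0 r₁; positivity, fun r hr => ?_⟩
  have hsub : Icc r₁ r ⊆ Ioi a := fun s hs => hr₁.trans_le hs.1
  have hd : ∀ s ∈ Icc r₁ r, HasDerivAt (fun s => y s / s ^ 2)
      ((zInt (Dr fun q => U q ^ 2) s * s ^ 2 - y s * (2 * s)) / (s ^ 2) ^ 2) s := by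
    intro s hs
    have hs0 : s ^ 2 ≠ 0 := by have := h1.trans_le hs.1; positivity
    exact (((hU.pow 2).hasDerivAt_zInt (hsub hs)).div ((hasDerivAt_id s).pow 2) hs0).congr_deriv
      (by simp [hy])
  have hb : ∀ s ∈ Icc r₁ r, (zInt (Dr fun q => U q ^ 2) s * s ^ 2 - y s * (2 * s)) / (s ^ 2) ^ 2
      ≤ (1 / r₁ ^ 2) * (s * zInt (fun q => Dr U q ^ 2) s) := by
    intro s hs
    have hs0 : 0 < s := h1.trans_le hs.1
    have has := hsub hs
    have k1 : s * zInt (Dr fun q => U q ^ 2) s ≤ 2 * y s + s ^ 2 * zInt (fun q => Dr U q ^ 2) s := by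
      rw [hy, ← zInt_const_mul, ← zInt_const_mul, ← zInt_const_mul]
      have i1 := ((SmoothHalf.const 2).mul (hU.pow 2)).intervalIntegrable has (-π) π
      have i2 := ((SmoothHalf.const (s ^ 2)).mul (hU.dr.pow 2)).intervalIntegrable has (-π) π
      rw [zInt, zInt, zInt, ← intervalIntegral.integral_add i1 i2]
      refine intervalIntegral.integral_mono_on (by linarith [pi_pos])
        (((SmoothHalf.const s).mul (hU.pow 2).dr).intervalIntegrable has _ _) (i1.add i2)
        fun z _ => ?_
      rw [(hU.pow 2).dr_eq has ((hU.hasDerivAt_dr has z).pow 2)]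
      simp
      nlinarith [sq_nonneg (U (s, z) - s * Dr U (s, z)), sq_nonneg (U (s, z))]
    have hg0 : 0 ≤ zInt (fun q => Dr U q ^ 2) s := zInt_nonneg fun z => sq_nonneg _
    rw [div_le_iff₀ (by positivity)]
    have hs1 : r₁ ^ 2 ≤ s ^ 2 := by have := hs.1; gcongr
    have k2 : s ^ 3 * zInt (fun q => Dr U q ^ 2) s ≤
        1 / r₁ ^ 2 * (s * zInt (fun q => Dr U q ^ 2) s) * (s ^ 2) ^ 2 := by
      calc s ^ 3 * zInt (fun q => Dr U q ^ 2) s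
          = 1 / r₁ ^ 2 * (s * zInt (fun q => Dr U q ^ 2) s) * (r₁ ^ 2 * s ^ 2) := by field_simp
        _ ≤ 1 / r₁ ^ 2 * (s * zInt (fun q => Dr U q ^ 2) s) * (s ^ 2 * s ^ 2) := by gcongr
        _ = _ := by ring
    nlinarith [mul_le_mul_of_nonneg_left k1 hs0.le]
  have hcont : ContinuousOn (fun s => (1 / r₁ ^ 2) * (s * zInt (fun q => Dr U q ^ 2) s))
      (Icc r₁ r) :=
    continuousOn_const.mul (continuousOn_id.mul ((hU.dr.pow 2).continuousOn_zInt.mono hsub))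
  have hi := intervalIntegral.sub_le_integral_of_hasDeriv_right_of_le hr
    (fun s hs => (hd s hs).continuousAt.continuousWithinAt)
    (fun s hs => (hd s (Ioo_subset_Icc_self hs)).hasDerivWithinAt)
    hcont.integrableOn_Icc (fun s hs => hb s (Ioo_subset_Icc_self hs))
  rw [intervalIntegral.integral_const_mul] at hi
  have hDr := mul_le_mul_of_nonneg_left (hD r hr) (show 0 ≤ 1 / r₁ ^ 2 by positivity)
  have hr0 : 0 < r := h1.trans_le hr
  rw [← div_le_iff₀ (by positivity)]
  calc y r / r ^ 2 ≤ y r₁ / r₁ ^ 2 + 1 / r₁ ^ 2 * D := by linarith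
    _ = _ := by ring

lemma vort_sq_le (h : MeridionalNS a U W P) {r : ℝ} (hr : a < r) (z : ℝ) :
    vort U W (r, z) ^ 2 ≤ zInt (fun q => vort U W q ^ 2) r +
      2 * zInt (fun q => |vort U W q * Dz (vort U W) q|) r := by
  obtain ⟨z', hz', hper⟩ := exists_mem_Icc_periodicZ_eq r z
  rw [← hper _ h.periodic_vort]
  exact sq_le_integral_sq_add (fun z => h.smooth_vort.hasDerivAt_dz hr z)
    (h.smooth_vort.dz.continuous_slice hr) hz'

lemma abs_zInt_mul_vort_sq_le (h : MeridionalNS a U W P) {r C : ℝ} (hr : a < r)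
    (hC : zInt (fun q => U q ^ 2) r ≤ C * r ^ 2) :
    |zInt (fun q => U q * vort U W q ^ 2) r| ≤ (C + 2 * π) * r *
      (zInt (fun q => vort U W q ^ 2) r +
      2 * zInt (fun q => |vort U W q * Dz (vort U W) q|) r) := by
  have hU := h.smooth_U.continuous_slice hr
  have hΩ := h.smooth_vort.continuous_slice hr
  have hr0 : 0 < r := h.pos.trans hr
  set S := zInt (fun q => vort U W q ^ 2) r +
      2 * zInt (fun q => |vort U W q * Dz (vort U W) q|) r with hS
  have hS0 : 0 ≤ S := (sq_nonneg _).trans (h.vort_sq_le hr 0)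
  have h1 : |zInt (fun q => U q * vort U W q ^ 2) r| ≤ zInt (fun q => |U q * vort U W q ^ 2|) r :=
    intervalIntegral.abs_integral_le_integral_abs (by linarith [pi_pos])
  have h2 : zInt (fun q => |U q * vort U W q ^ 2|) r ≤
      zInt (fun q => S * (1 / r * U q ^ 2 + r)) r := by
    refine zInt_mono (hU.mul (hΩ.pow 2)).abs
      ((((hU.pow 2).const_mul (1 / r)).add continuous_const).const_mul S) fun z => ?_
    have hS1 := h.vort_sq_le hr z
    rw [abs_mul, abs_of_nonneg (sq_nonneg (vort U W (r, z))), mul_comm]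
    have hU1 : |U (r, z)| ≤ 1 / r * U (r, z) ^ 2 + r := by
      have : 1 / r * U (r, z) ^ 2 + r - |U (r, z)| =
          (1 / r) * ((|U (r, z)| - r / 2) ^ 2 + 3 / 4 * r ^ 2) := by
        rw [← sq_abs (U (r, z))]; field_simp; ring
      have : 0 ≤ 1 / r * U (r, z) ^ 2 + r - |U (r, z)| := by rw [this]; positivity
      linarith
    gcongr
  have h3 : zInt (fun q => S * (1 / r * U q ^ 2 + r)) r =
      S * (1 / r * zInt (fun q => U q ^ 2) r + 2 * π * r) := by
    have h5 : zInt (fun q => 1 / r * U q ^ 2 + r) r =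
        1 / r * zInt (fun q => U q ^ 2) r + 2 * π * r := by
      rw [← zInt_const_mul]
      refine (intervalIntegral.integral_add
        (((hU.pow 2).const_mul (1 / r)).intervalIntegrable (μ := volume) _ _)
        (continuous_const.intervalIntegrable _ _)).trans ?_
      rw [intervalIntegral.integral_const, smul_eq_mul]
      simp only [zInt, Pi.pow_apply]
      ring
    exact (zInt_const_mul S r).trans (by rw [h5])
  have h4 : 1 / r * zInt (fun q => U q ^ 2) r ≤ C * r := by
    calc 1 / r * zInt (fun q => U q ^ 2) r ≤ 1 / r * (C * r ^ 2) := by gcongr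
      _ = C * r := by field_simp
  calc _ ≤ S * (1 / r * zInt (fun q => U q ^ 2) r + 2 * π * r) := h1.trans (h2.trans h3.le)
    _ ≤ S * (C * r + 2 * π * r) := by gcongr
    _ = _ := by ring

lemma young_zInt (h : MeridionalNS a U W P) {r : ℝ} (hr : a < r) (c d : ℝ) :
    2 * c * d * zInt (fun q => |vort U W q * Dz (vort U W) q|) r ≤
      c ^ 2 * zInt (fun q => vort U W q ^ 2) r +
      d ^ 2 * zInt (fun q => Dr (vort U W) q ^ 2 + Dz (vort U W) q ^ 2) r := by
  have hΩ := h.smooth_vort.continuous_slice hr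
  have hz := h.smooth_vort.dz.continuous_slice hr
  have hd := h.smooth_vort.dr.continuous_slice hr
  rw [← zInt_const_mul, ← zInt_const_mul, ← zInt_const_mul]
  refine le_of_le_of_eq (zInt_mono
    (g := fun q => c ^ 2 * vort U W q ^ 2 + d ^ 2 * (Dr (vort U W) q ^ 2 + Dz (vort U W) q ^ 2))
    (continuous_const.mul (hΩ.mul hz).abs)
    ((continuous_const.mul (hΩ.pow 2)).add (continuous_const.mul ((hd.pow 2).add (hz.pow 2))))
    fun z => ?_) ?_
  · rw [abs_mul, ← sq_abs (vort U W (r, z)), ← sq_abs (Dz (vort U W) (r, z))]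
    nlinarith [sq_nonneg (c * |vort U W (r, z)| - d * |Dz (vort U W) (r, z)|),
      sq_nonneg (d * Dr (vort U W) (r, z))]
  · exact intervalIntegral.integral_add
      ((continuous_const.mul (hΩ.pow 2)).intervalIntegrable (μ := volume) _ _)
      ((continuous_const.mul ((hd.pow 2).add (hz.pow 2))).intervalIntegrable _ _)

lemma zInt_vort_sq_le (h : MeridionalNS a U W P) {r : ℝ} (hr : a < r) :
    zInt (fun q => vort U W q ^ 2) r ≤
      2 / r ^ 3 * (r * zInt (fun q => Dr U q ^ 2 + Dz U q ^ 2 + Dr W q ^ 2) r) := by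
  have hr0 : 0 < r := h.pos.trans hr
  have hU := h.smooth_U.dr.continuous_slice hr
  have hU' := h.smooth_U.dz.continuous_slice hr
  have hW := h.smooth_W.dr.continuous_slice hr
  have e : 2 / r ^ 3 * (r * zInt (fun q => Dr U q ^ 2 + Dz U q ^ 2 + Dr W q ^ 2) r) =
      zInt (fun q => 2 / r ^ 2 * (Dr U q ^ 2 + Dz U q ^ 2 + Dr W q ^ 2)) r := by
    rw [zInt_const_mul]; field_simp
  rw [e]
  refine zInt_mono ((h.smooth_vort.continuous_slice hr).pow 2)
    (continuous_const.mul (((hU.pow 2).add (hU'.pow 2)).add (hW.pow 2))) fun z => ?_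
  simp only [vort, div_pow, div_mul_eq_mul_div]
  gcongr
  nlinarith [sq_nonneg (Dz U (r, z) + Dr W (r, z)), sq_nonneg (Dr U (r, z))]

/-- In every dyadic shell there is a radius on which the vorticity is small. -/
lemma exists_radius_vort_sq_le (h : MeridionalNS a U W P) {r₁ D : ℝ} (hr₁ : a < r₁)
    (hD : ∀ R ≥ r₁, ∫ s in r₁..R,
      s * zInt (fun q => Dr U q ^ 2 + Dz U q ^ 2 + Dr W q ^ 2) s ≤ D) :
    ∃ K, 0 ≤ K ∧ ∀ R, r₁ ≤ R → 1 ≤ R →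
      ∃ s ∈ Icc (2 * R) (3 * R), ∀ z, vort U W (s, z) ^ 2 ≤ K / R ^ 4 := by
  have hU := h.smooth_U
  have hΩ := h.smooth_vort
  set G : ℝ × ℝ → ℝ := fun q => Dr U q ^ 2 + Dz U q ^ 2 + Dr W q ^ 2 with hGdef
  have hG : SmoothHalf a G := ((hU.dr.pow 2).add (hU.dz.pow 2)).add (h.smooth_W.dr.pow 2)
  have hG0 : ∀ r, 0 ≤ zInt G r := fun r => zInt_nonneg fun z => by simp only [hGdef]; positivity
  have hD0 : 0 ≤ D := by simpa using hD r₁ le_rfl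
  have hGc : ContinuousOn (fun s => s * zInt G s) (Ioi a) :=
    continuousOn_id.mul hG.continuousOn_zInt
  have h1 : 0 < r₁ := h.pos.trans hr₁
  have hDU : ∀ R ≥ r₁, ∫ s in r₁..R, s * zInt (fun q => Dr U q ^ 2) s ≤ D := by
    intro R hR
    have hsub : Icc r₁ R ⊆ Ioi a := fun s hs => hr₁.trans_le hs.1
    refine le_trans (intervalIntegral.integral_mono_on hR ?_ ?_ fun s hs => ?_) (hD R hR)
    · exact ((continuousOn_id.mul (hU.dr.pow 2).continuousOn_zInt).mono
        hsub).intervalIntegrable_of_Icc hR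
    · exact (hGc.mono hsub).intervalIntegrable_of_Icc hR
    · have hs0 : 0 < s := h1.trans_le hs.1
      gcongr
      refine zInt_mono ((hU.dr.pow 2).continuous_slice (hsub hs))
        (hG.continuous_slice (hsub hs)) fun z => ?_
      simp only [hGdef]
      nlinarith [sq_nonneg (Dz U (s, z)), sq_nonneg (Dr W (s, z))]
  obtain ⟨C, hC0, hC⟩ := h.exists_zInt_sq_le hr₁ hDU
  set C' := C + 2 * π with hC'
  have hC'0 : 0 ≤ C' := by positivity
  set L := 90 + 288 * C' + 2304 * C' ^ 2 with hL
  have hL0 : 0 ≤ L := by positivity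
  set A := zInt (fun q => vort U W q ^ 2) with hAdef
  set E := zInt (fun q => Dr (vort U W) q ^ 2 + Dz (vort U W) q ^ 2) with hEdef
  have hEc : ContinuousOn E (Ioi a) := ((hΩ.dr.pow 2).add (hΩ.dz.pow 2)).continuousOn_zInt
  have hAc : ContinuousOn A (Ioi a) := (hΩ.pow 2).continuousOn_zInt
  refine ⟨(2 + L) * (2 * D) + 1, by positivity, fun R hR hR1 => ?_⟩
  have hRp : 0 < R := by linarith
  have hsub : Icc R (4 * R) ⊆ Ioi a := fun s hs => hr₁.trans_le (hR.trans hs.1)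
  have hsub' : Icc (2 * R) (3 * R) ⊆ Icc R (4 * R) := Icc_subset_Icc (by linarith) (by linarith)
  have hle : R ≤ 4 * R := by linarith
  have hA0 : ∀ r, 0 ≤ A r := fun r => zInt_nonneg fun z => sq_nonneg _
  have hA : ∫ s in R..(4 * R), A s ≤ 2 * D / R ^ 3 := by
    have i1 : IntervalIntegrable (fun s => s * zInt G s) volume R (4 * R) :=
      (hGc.mono hsub).intervalIntegrable_of_Icc hle
    calc ∫ s in R..(4 * R), A s ≤ ∫ s in R..(4 * R), 2 / R ^ 3 * (s * zInt G s) := by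
          refine intervalIntegral.integral_mono_on hle
            ((hAc.mono hsub).intervalIntegrable_of_Icc hle) (i1.const_mul _) fun s hs => ?_
          refine (h.zInt_vort_sq_le (hsub hs)).trans ?_
          have hs0 : 0 < s := hRp.trans_le hs.1
          have hRs := hs.1
          have := hG0 s
          gcongr
      _ = 2 / R ^ 3 * ∫ s in R..(4 * R), s * zInt G s :=
          intervalIntegral.integral_const_mul _ _
      _ ≤ 2 / R ^ 3 * ∫ s in r₁..(4 * R), s * zInt G s := by
          gcongr
          refine intervalIntegral.integral_mono_interval hR hle le_rfl ?_
            ((hGc.mono fun s hs => hr₁.trans_le hs.1).intervalIntegrable_of_Icc (hR.trans hle))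
          filter_upwards [ae_restrict_mem measurableSet_Ioc] with s hs
          exact mul_nonneg (h1.trans hs.1).le (hG0 s)
      _ ≤ 2 / R ^ 3 * D := by gcongr; exact hD _ (hR.trans hle)
      _ = 2 * D / R ^ 3 := by ring
  have hflux := integral_le_of_flux_identity (A := A) (A' := zInt (Dr fun q => vort U W q ^ 2))
    (E := E) (B := zInt (fun q => U q * vort U W q ^ 2))
    (N := zInt (fun q => |vort U W q * Dz (vort U W) q|)) (R := R) hC'0 hR1
    (fun r hr => (hΩ.pow 2).hasDerivAt_zInt (hsub hr)) (fun r hr => h.hasDerivAt_flux (hsub hr))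
    (fun r hr => by
      have hr' := hsub hr
      have cΩ := hΩ.continuous_slice hr'
      have cD := (hΩ.pow 2).dr.continuous_slice hr'
      have cU := hU.continuous_slice hr'
      rw [hAdef, ← zInt_const_mul, ← zInt_const_mul, ← zInt_const_mul]
      have i1 := ((continuous_const (y := r)).mul cD).intervalIntegrable (μ := volume) (-π) π
      have i2 := ((continuous_const (y := (2 : ℝ))).mul
        (cΩ.pow 2)).intervalIntegrable (μ := volume) (-π) π
      have i3 := ((continuous_const (y := r)).mul
        (cU.mul (cΩ.pow 2))).intervalIntegrable (μ := volume) (-π) π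
      refine Eq.trans ?_ ((intervalIntegral.integral_sub (i1.add i2) i3).trans
        (congrArg (· - _) (intervalIntegral.integral_add i1 i2)))
      refine intervalIntegral.integral_congr fun z _ => ?_
      have e : Dr (fun q => vort U W q ^ 2) (r, z) = 2 * vort U W (r, z) * Dr (vort U W) (r, z) :=
        (hΩ.pow 2).dr_eq hr' (((hΩ.hasDerivAt_dr hr' z).pow 2).congr_deriv (by simp))
      simp [e])
    (hEc.mono hsub) (fun r _ => hA0 r) (fun r _ => zInt_nonneg fun z => by positivity)
    (fun r hr => h.abs_zInt_mul_vort_sq_le (hsub hr) (hC r (hR.trans hr.1)))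
    (fun r hr c d => h.young_zInt (hsub hr) c d)
  have iA : IntervalIntegrable A volume (2 * R) (3 * R) :=
    (hAc.mono (hsub'.trans hsub)).intervalIntegrable_of_Icc (by linarith)
  have iE : IntervalIntegrable E volume (2 * R) (3 * R) :=
    (hEc.mono (hsub'.trans hsub)).intervalIntegrable_of_Icc (by linarith)
  have hAmid : ∫ s in (2 * R)..(3 * R), A s ≤ ∫ s in R..(4 * R), A s :=
    intervalIntegral.integral_mono_interval (by linarith) (by linarith) (by linarith)
      (Eventually.of_forall hA0) ((hAc.mono hsub).intervalIntegrable_of_Icc hle)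
  have hsum : ∫ s in (2 * R)..(3 * R), (2 * A s + E s) ≤ (2 + L) * (2 * D) / R ^ 3 := by
    rw [intervalIntegral.integral_add (iA.const_mul _) iE, intervalIntegral.integral_const_mul]
    have := mul_le_mul_of_nonneg_left hA (show 0 ≤ 2 + L by positivity)
    calc _ ≤ (2 + L) * ∫ s in R..(4 * R), A s := by linarith
      _ ≤ (2 + L) * (2 * D / R ^ 3) := this
      _ = _ := by ring
  have hex : ∃ s ∈ Icc (2 * R) (3 * R), 2 * A s + E s ≤ ((2 + L) * (2 * D) + 1) / R ^ 4 := by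
    by_contra! hcon
    have hlow := intervalIntegral.integral_mono_on (by linarith : 2 * R ≤ 3 * R)
      intervalIntegrable_const ((iA.const_mul 2).add iE) fun s hs => (hcon s hs).le
    rw [intervalIntegral.integral_const, smul_eq_mul] at hlow
    have e : (3 * R - 2 * R) * (((2 + L) * (2 * D) + 1) / R ^ 4) =
        (2 + L) * (2 * D) / R ^ 3 + 1 / R ^ 3 := by field_simp; ring
    rw [e] at hlow
    have : 0 < 1 / R ^ 3 := by positivity
    exact absurd (hlow.trans hsum) (by linarith)
  obtain ⟨s, hs, hs'⟩ := hex
  refine ⟨s, hs, fun z => ?_⟩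
  have has := hsub (hsub' hs)
  have hv := h.vort_sq_le has z
  have hy := h.young_zInt has 1 1
  refine hv.trans (le_trans ?_ hs')
  simp only [one_pow, one_mul, mul_one] at hy
  linarith

/-- A solution with finite Dirichlet integral has vorticity `Ω = O(r⁻²)`. -/
lemma exists_abs_vort_le (h : MeridionalNS a U W P) {r₁ D : ℝ} (hr₁ : a < r₁)
    (hD : ∀ R ≥ r₁, ∫ s in r₁..R,
      s * zInt (fun q => Dr U q ^ 2 + Dz U q ^ 2 + Dr W q ^ 2) s ≤ D) :
    ∃ K R₀, ∀ r ≥ R₀, ∀ z, |vort U W (r, z)| ≤ K / r ^ 2 := by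
  obtain ⟨K, hK, hshell⟩ := h.exists_radius_vort_sq_le hr₁ hD
  refine ⟨9 * √K, 3 * max r₁ 1, fun r hr z => ?_⟩
  have hm1 := le_max_left r₁ 1
  have hm2 := le_max_right r₁ 1
  have hr0 : 0 < r := by linarith
  have bound : ∀ R, r / 3 ≤ R → ∀ s, (∀ z, vort U W (s, z) ^ 2 ≤ K / R ^ 4) →
      ∀ z, |vort U W (s, z)| ≤ 9 * √K / r ^ 2 := by
    intro R hR s hs z
    refine abs_le_of_sq_le_sq ((hs z).trans ?_) (by positivity)
    have : (9 * √K / r ^ 2) ^ 2 = K / (r / 3) ^ 4 := by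
      rw [div_pow, mul_pow, sq_sqrt hK]; field_simp; ring
    rw [this]
    gcongr
  obtain ⟨s₁, hs₁, hb₁⟩ := hshell (r / 3) (by linarith) (by linarith)
  obtain ⟨s₂, hs₂, hb₂⟩ := hshell (r / 2) (by linarith) (by linarith)
  have b₁ := bound _ le_rfl s₁ hb₁
  have b₂ := bound _ (by linarith) s₂ hb₂
  have hΩ := h.smooth_vort
  have ha : a < s₁ := by linarith [hs₁.1]
  have hrs : r ∈ Icc s₁ s₂ := ⟨by linarith [hs₁.2], by linarith [hs₂.1]⟩
  have hb : SmoothHalf a fun q => U q - 3 / q.1 :=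
    h.smooth_U.sub ((SmoothHalf.const 3).div_fst h.pos)
  refine abs_le'.2 ⟨?_, ?_⟩
  · refine le_of_elliptic_eq (w := W) ha hΩ h.periodic_vort hb (fun q hq => ?_)
      (fun z => (abs_le'.1 (b₁ z)).1) (fun z => (abs_le'.1 (b₂ z)).1) hrs
    linear_combination h.vorticity_equation hq
  · have hneg : SmoothHalf a fun q => -vort U W q := ContDiffOn.neg hΩ
    refine le_of_elliptic_eq (f := fun q => -vort U W q) (w := W) ha hneg
      (fun q => by simp [h.periodic_vort q]) hb (fun q hq => ?_)
      (fun z => (abs_le'.1 (b₁ z)).2) (fun z => (abs_le'.1 (b₂ z)).2) hrs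
    have n1 : ∀ f : ℝ × ℝ → ℝ, Dr (fun q => -f q) = fun q => -Dr f q := fun f => by
      funext q; simp [Dr, fderiv_fun_neg]
    have n2 : ∀ f : ℝ × ℝ → ℝ, Dz (fun q => -f q) = fun q => -Dz f q := fun f => by
      funext q; simp [Dz, fderiv_fun_neg]
    simp only [n1, n2]
    linear_combination -h.vorticity_equation hq

end MeridionalNS

/-- The standard basis vectors of three-dimensional space. -/
abbrev basisVec (i : Fin 3) : E3 := EuclideanSpace.single i 1

/-- The embedding `(r, z) ↦ (r, 0, z)` of the meridional plane. -/
def merid : ℝ × ℝ →L[ℝ] E3 :=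
  (ContinuousLinearMap.fst ℝ ℝ ℝ).smulRight (basisVec 0) +
    (ContinuousLinearMap.snd ℝ ℝ ℝ).smulRight (basisVec 2)

lemma merid_apply (q : ℝ × ℝ) : merid q = q.1 • basisVec 0 + q.2 • basisVec 2 := rfl

@[simp] lemma merid_zero (q : ℝ × ℝ) : merid q 0 = q.1 := by simp [merid_apply]

@[simp] lemma merid_one (q : ℝ × ℝ) : merid q 1 = 0 := by simp [merid_apply]

@[simp] lemma merid_two (q : ℝ × ℝ) : merid q 2 = q.2 := by simp [merid_apply]

lemma rr_merid {q : ℝ × ℝ} (hq : 0 ≤ q.1) : rr (merid q) = q.1 := by simp [rr, sqrt_sq hq]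

lemma rr_sq (x : E3) : rr x ^ 2 = x 0 ^ 2 + x 1 ^ 2 := sq_sqrt (by positivity)

lemma continuous_rr : Continuous rr := by unfold rr; fun_prop

lemma isOpen_lt_rr (a : ℝ) : IsOpen {x : E3 | a < rr x} := isOpen_lt continuous_const continuous_rr

/-- Smoothness outside the cylinder of radius `a`. -/
def SmoothOutside (a : ℝ) (g : E3 → ℝ) : Prop := ContDiffOn ℝ (⊤ : ℕ∞) g {x : E3 | a < rr x}

namespace SmoothOutside

variable {a : ℝ} {g : E3 → ℝ}

lemma pd (hg : SmoothOutside a g) (i : Fin 3) : SmoothOutside a (pd i g) :=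
  (ContDiffOn.fderiv_of_isOpen hg (isOpen_lt_rr a) (by simp)).clm_apply contDiffOn_const

lemma differentiableAt (hg : SmoothOutside a g) {x : E3} (hx : a < rr x) :
    DifferentiableAt ℝ g x :=
  (ContDiffOn.contDiffAt hg ((isOpen_lt_rr a).mem_nhds hx)).differentiableAt (by simp)

lemma comp_merid (hg : SmoothOutside a g) (ha : 0 < a) : SmoothHalf a fun q => g (merid q) :=
  ContDiffOn.comp hg merid.contDiff.contDiffOn fun q (hq : a < q.1) => by
    simpa [rr_merid (ha.trans hq).le] using hq

lemma fderiv_comp_merid (hg : SmoothOutside a g) (ha : 0 < a) {q : ℝ × ℝ} (hq : a < q.1)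
    (w : ℝ × ℝ) :
    fderiv ℝ (fun q => g (merid q)) q w = fderiv ℝ g (merid q) (merid w) := by
  have h := (hg.differentiableAt (x := merid q)
    (by rwa [rr_merid (ha.trans hq).le])).hasFDerivAt.comp q merid.hasFDerivAt
  exact congrArg (fun L => L w) h.fderiv

lemma Dr_comp_merid (hg : SmoothOutside a g) (ha : 0 < a) {q : ℝ × ℝ} (hq : a < q.1) :
    Dr (fun q => g (merid q)) q = _root_.pd 0 g (merid q) := by
  rw [Dr, hg.fderiv_comp_merid ha hq]
  simp [_root_.pd, merid_apply]

lemma Dz_comp_merid (hg : SmoothOutside a g) (ha : 0 < a) {q : ℝ × ℝ} (hq : a < q.1) :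
    Dz (fun q => g (merid q)) q = _root_.pd 2 g (merid q) := by
  rw [Dz, hg.fderiv_comp_merid ha hq]
  simp [_root_.pd, merid_apply]

lemma Dr_Dr_comp_merid (hg : SmoothOutside a g) (ha : 0 < a) {q : ℝ × ℝ} (hq : a < q.1) :
    Dr (Dr fun q => g (merid q)) q = _root_.pd 0 (_root_.pd 0 g) (merid q) := by
  rw [Dr_congr (fun q hq => hg.Dr_comp_merid ha hq) hq, (hg.pd 0).Dr_comp_merid ha hq]

lemma Dz_Dz_comp_merid (hg : SmoothOutside a g) (ha : 0 < a) {q : ℝ × ℝ} (hq : a < q.1) :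
    Dz (Dz fun q => g (merid q)) q = _root_.pd 2 (_root_.pd 2 g) (merid q) := by
  rw [Dz_congr (fun q hq => hg.Dz_comp_merid ha hq) hq, (hg.pd 2).Dz_comp_merid ha hq]

lemma hasDerivAt_line (hg : SmoothOutside a g) {x : E3} {t : ℝ} (w : E3)
    (hx : a < rr (x + t • w)) :
    HasDerivAt (fun s => g (x + s • w)) (fderiv ℝ g (x + t • w) w) t := by
  have h : HasDerivAt (fun s : ℝ => x + s • w) w t := by
    simpa using ((hasDerivAt_id t).smul_const w).const_add x
  exact (hg.differentiableAt hx).hasFDerivAt.comp_hasDerivAt t h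

end SmoothOutside

/-- The distance to the axis along the line through `(r, 0, z)` in direction `e₂`. -/
lemma rr_merid_add (q : ℝ × ℝ) (t : ℝ) : rr (merid q + t • basisVec 1) = √(q.1 ^ 2 + t ^ 2) := by
  simp [rr]

lemma le_sqrt_sq_add_sq (r t : ℝ) : r ≤ √(r ^ 2 + t ^ 2) :=
  le_sqrt_of_sq_le (by nlinarith [sq_nonneg t])

lemma hasDerivAt_sqrt_sq_add_sq {r : ℝ} (hr : 0 < r) (t : ℝ) :
    HasDerivAt (fun t => √(r ^ 2 + t ^ 2)) (t / √(r ^ 2 + t ^ 2)) t := by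
  have h0 : HasDerivAt (fun t : ℝ => r ^ 2 + t ^ 2) (2 * t) t := by
    simpa using ((hasDerivAt_id t).pow 2).const_add (r ^ 2)
  refine (h0.sqrt (by positivity)).congr_deriv ?_
  field_simp

lemma SmoothHalf.hasDerivAt_comp_sqrt {a r : ℝ} {f : ℝ × ℝ → ℝ} (hf : SmoothHalf a f)
    (ha : 0 < a) (hr : a < r) (z t : ℝ) :
    HasDerivAt (fun t => f (√(r ^ 2 + t ^ 2), z))
      (Dr f (√(r ^ 2 + t ^ 2), z) * (t / √(r ^ 2 + t ^ 2))) t :=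
  HasDerivAt.comp (h₂ := fun s => f (s, z)) t
    (hf.hasDerivAt_dr (hr.trans_le (le_sqrt_sq_add_sq r t)) z)
    (hasDerivAt_sqrt_sq_add_sq (ha.trans hr) t)

lemma hasDerivAt_id_mul {k : ℝ → ℝ} (hk : ContinuousAt k 0) :
    HasDerivAt (fun t => t * k t) (k 0) 0 := by
  rw [hasDerivAt_iff_tendsto_slope_zero]
  refine (hk.tendsto.mono_left nhdsWithin_le_nhds).congr' ?_
  filter_upwards [self_mem_nhdsWithin] with t ht
  have : t ≠ 0 := ht
  simp [this]

namespace AxisymNoSwirlNSSlab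

variable {r₀ : ℝ} {v : E3 → E3} {p : E3 → ℝ} {vr vz : ℝ → ℝ → ℝ}

lemma smooth_comp (h : AxisymNoSwirlNSSlab r₀ v p vr vz) (j : Fin 3) :
    SmoothOutside r₀ fun x => v x j :=
  contDiffOn_euclidean.1 h.smooth_v j

lemma merid_comp_zero (h : AxisymNoSwirlNSSlab r₀ v p vr vz) (hr₀ : 0 < r₀) {q : ℝ × ℝ}
    (hq : r₀ < q.1) : v (merid q) 0 = vr q.1 q.2 := by
  have hq0 := hr₀.trans hq
  have e := rr_merid hq0.le
  rw [(h.axisym_no_swirl (merid q) (by rwa [e])).1, e]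
  simp [hq0.ne']

lemma merid_comp_one (h : AxisymNoSwirlNSSlab r₀ v p vr vz) (hr₀ : 0 < r₀) {q : ℝ × ℝ}
    (hq : r₀ < q.1) : v (merid q) 1 = 0 := by
  rw [(h.axisym_no_swirl (merid q) (by rwa [rr_merid (hr₀.trans hq).le])).2.1]
  simp

lemma merid_comp_two (h : AxisymNoSwirlNSSlab r₀ v p vr vz) (hr₀ : 0 < r₀) {q : ℝ × ℝ}
    (hq : r₀ < q.1) : v (merid q) 2 = vz q.1 q.2 := by
  have e := rr_merid (hr₀.trans hq).le
  rw [(h.axisym_no_swirl (merid q) (by rwa [e])).2.2, e, merid_two]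

/-- The velocity is determined by its values on the meridional half plane. -/
lemma eq_merid (h : AxisymNoSwirlNSSlab r₀ v p vr vz) (hr₀ : 0 < r₀) {x : E3} (hx : r₀ < rr x) :
    v x 0 = v (merid (rr x, x 2)) 0 * (x 0 / rr x) ∧
    v x 1 = v (merid (rr x, x 2)) 0 * (x 1 / rr x) ∧
    v x 2 = v (merid (rr x, x 2)) 2 := by
  rw [h.merid_comp_zero hr₀ hx, h.merid_comp_two hr₀ hx]
  exact h.axisym_no_swirl x hx

lemma eq_merid_line (h : AxisymNoSwirlNSSlab r₀ v p vr vz) (hr₀ : 0 < r₀) {q : ℝ × ℝ}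
    (hq : r₀ < q.1) (t : ℝ) :
    v (merid q + t • basisVec 1) 0 =
      v (merid (√(q.1 ^ 2 + t ^ 2), q.2)) 0 * (q.1 / √(q.1 ^ 2 + t ^ 2)) ∧
    v (merid q + t • basisVec 1) 1 =
      v (merid (√(q.1 ^ 2 + t ^ 2), q.2)) 0 * (t / √(q.1 ^ 2 + t ^ 2)) ∧
    v (merid q + t • basisVec 1) 2 = v (merid (√(q.1 ^ 2 + t ^ 2), q.2)) 2 := by
  have h1 := h.eq_merid hr₀ (x := merid q + t • basisVec 1)
    (by rw [rr_merid_add]; exact hq.trans_le (le_sqrt_sq_add_sq _ _))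
  rw [rr_merid_add] at h1
  simpa using h1

lemma pd_one_comp_one (h : AxisymNoSwirlNSSlab r₀ v p vr vz) (hr₀ : 0 < r₀) {q : ℝ × ℝ}
    (hq : r₀ < q.1) : pd 1 (fun x => v x 1) (merid q) = v (merid q) 0 / q.1 := by
  have hq0 := hr₀.trans hq
  have hU := (h.smooth_comp 0).comp_merid hr₀
  have hd := (h.smooth_comp 1).hasDerivAt_line (x := merid q) (t := 0) (basisVec 1)
    (by simpa [rr_merid hq0.le] using hq)
  have hk : ContinuousAt (fun t : ℝ => v (merid (√(q.1 ^ 2 + t ^ 2), q.2)) 0 /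
      √(q.1 ^ 2 + t ^ 2)) 0 := by
    exact (hU.hasDerivAt_comp_sqrt hr₀ hq q.2 0).continuousAt.div
      (hasDerivAt_sqrt_sq_add_sq hq0 0).continuousAt (by positivity)
  have h2 := hd.unique ((hasDerivAt_id_mul hk).congr_of_eventuallyEq
    (Eventually.of_forall fun t => (h.eq_merid_line hr₀ hq t).2.1.trans (by ring)))
  simpa [pd, sqrt_sq hq0.le] using h2

lemma pd_one_pd_one_comp_two (h : AxisymNoSwirlNSSlab r₀ v p vr vz) (hr₀ : 0 < r₀) {q : ℝ × ℝ}
    (hq : r₀ < q.1) :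
    pd 1 (pd 1 fun x => v x 2) (merid q) = Dr (fun q => v (merid q) 2) q / q.1 := by
  have hq0 := hr₀.trans hq
  have hW := (h.smooth_comp 2).comp_merid hr₀
  have hρ := hasDerivAt_sqrt_sq_add_sq hq0
  have hle := fun t => hq.trans_le (le_sqrt_sq_add_sq q.1 t)
  have h1 : ∀ t : ℝ, pd 1 (fun x => v x 2) (merid q + t • basisVec 1) =
      t * (Dr (fun q => v (merid q) 2) (√(q.1 ^ 2 + t ^ 2), q.2) / √(q.1 ^ 2 + t ^ 2)) := by
    intro t
    have hd := (h.smooth_comp 2).hasDerivAt_line (x := merid q) (t := t) (basisVec 1)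
      (by rw [rr_merid_add]; exact hle t)
    refine (hd.unique ((hW.hasDerivAt_comp_sqrt hr₀ hq q.2 t).congr_of_eventuallyEq
      (Eventually.of_forall fun t => (h.eq_merid_line hr₀ hq t).2.2))).trans ?_
    ring
  have hk : ContinuousAt (fun t : ℝ => Dr (fun q => v (merid q) 2) (√(q.1 ^ 2 + t ^ 2), q.2) /
      √(q.1 ^ 2 + t ^ 2)) 0 :=
    (hW.dr.hasDerivAt_comp_sqrt hr₀ hq q.2 0).continuousAt.div
      (hρ 0).continuousAt (by positivity)
  have hd := ((h.smooth_comp 2).pd 1).hasDerivAt_line (x := merid q) (t := 0) (basisVec 1)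
    (by simpa [rr_merid hq0.le] using hq)
  have h2 := hd.unique ((hasDerivAt_id_mul hk).congr_of_eventuallyEq (Eventually.of_forall h1))
  simp only [zero_smul, add_zero, ne_eq, OfNat.ofNat_ne_zero, not_false_eq_true, zero_pow,
    sqrt_sq hq0.le] at h2
  exact h2

lemma pd_one_pd_one_comp_zero (h : AxisymNoSwirlNSSlab r₀ v p vr vz) (hr₀ : 0 < r₀) {q : ℝ × ℝ}
    (hq : r₀ < q.1) :
    pd 1 (pd 1 fun x => v x 0) (merid q) =
      Dr (fun q => v (merid q) 0) q / q.1 - v (merid q) 0 / q.1 ^ 2 := by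
  have hq0 := hr₀.trans hq
  have hU := (h.smooth_comp 0).comp_merid hr₀
  have hρ := hasDerivAt_sqrt_sq_add_sq hq0
  have hle := fun t => hq.trans_le (le_sqrt_sq_add_sq q.1 t)
  have hne : ∀ t : ℝ, √(q.1 ^ 2 + t ^ 2) ≠ 0 := fun t => (hr₀.trans (hle t)).ne'
  have h1 : ∀ t : ℝ, pd 1 (fun x => v x 0) (merid q + t • basisVec 1) =
      t * (q.1 * (Dr (fun q => v (merid q) 0) (√(q.1 ^ 2 + t ^ 2), q.2) / √(q.1 ^ 2 + t ^ 2) ^ 2 -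
        v (merid (√(q.1 ^ 2 + t ^ 2), q.2)) 0 / √(q.1 ^ 2 + t ^ 2) ^ 3)) := by
    intro t
    have hd := (h.smooth_comp 0).hasDerivAt_line (x := merid q) (t := t) (basisVec 1)
      (by rw [rr_merid_add]; exact hle t)
    refine (hd.unique (((hU.hasDerivAt_comp_sqrt hr₀ hq q.2 t).mul
      ((hasDerivAt_const t q.1).fun_div (hρ t) (hne t))).congr_of_eventuallyEq
      (Eventually.of_forall fun t => (h.eq_merid_line hr₀ hq t).1))).trans ?_
    have := hne t
    field_simp
    ring
  have hk : ContinuousAt (fun t : ℝ => q.1 * (Dr (fun q => v (merid q) 0)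
      (√(q.1 ^ 2 + t ^ 2), q.2) / √(q.1 ^ 2 + t ^ 2) ^ 2 -
        v (merid (√(q.1 ^ 2 + t ^ 2), q.2)) 0 / √(q.1 ^ 2 + t ^ 2) ^ 3)) 0 :=
    continuousAt_const.mul
      (((hU.dr.hasDerivAt_comp_sqrt hr₀ hq q.2 0).continuousAt.div
        ((hρ 0).continuousAt.pow 2) (pow_ne_zero _ (hne 0))).sub
      ((hU.hasDerivAt_comp_sqrt hr₀ hq q.2 0).continuousAt.div
        ((hρ 0).continuousAt.pow 3) (pow_ne_zero _ (hne 0))))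
  have hd := ((h.smooth_comp 0).pd 1).hasDerivAt_line (x := merid q) (t := 0) (basisVec 1)
    (by simpa [rr_merid hq0.le] using hq)
  have h2 := hd.unique ((hasDerivAt_id_mul hk).congr_of_eventuallyEq (Eventually.of_forall h1))
  simp only [zero_smul, add_zero, ne_eq, OfNat.ofNat_ne_zero, not_false_eq_true, zero_pow,
    sqrt_sq hq0.le] at h2
  refine Eq.trans h2 ?_
  field_simp

/-- The restriction to the meridional half plane solves the Navier–Stokes equations in
cylindrical coordinates. -/
lemma meridionalNS (h : AxisymNoSwirlNSSlab r₀ v p vr vz) (hr₀ : 0 < r₀) :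
    MeridionalNS r₀ (fun q => v (merid q) 0) (fun q => v (merid q) 2) (fun q => p (merid q)) := by
  have h0 := h.smooth_comp 0
  have h2 := h.smooth_comp 2
  have hp : SmoothOutside r₀ p := h.smooth_p
  have hper : ∀ q : ℝ × ℝ, v (merid (q + (0, 2 * π))) = v (merid q) := fun q => by
    rw [← h.periodic (merid q), map_add]
    congr 2
    simp [merid_apply]
  have hS : ∀ q : ℝ × ℝ, r₀ < q.1 → r₀ < rr (merid q) := fun q hq => by
    rwa [rr_merid (hr₀.trans hq).le]
  refine ⟨hr₀, h0.comp_merid hr₀, h2.comp_merid hr₀, hp.comp_merid hr₀,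
    fun q => by simp only [hper], fun q => by simp only [hper], fun q hq => ?_, fun q hq => ?_, fun q hq => ?_⟩
  · have m := h.momentum (merid q) (hS q hq) 0
    simp only [Fin.sum_univ_three, h.merid_comp_one hr₀ hq, h.pd_one_pd_one_comp_zero hr₀ hq] at m
    rw [h0.Dr_Dr_comp_merid hr₀ hq, h0.Dz_Dz_comp_merid hr₀ hq, h0.Dz_comp_merid hr₀ hq,
      hp.Dr_comp_merid hr₀ hq]
    have e := h0.Dr_comp_merid hr₀ hq
    rw [← e] at m
    linear_combination m
  · have m := h.momentum (merid q) (hS q hq) 2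
    simp only [Fin.sum_univ_three, h.merid_comp_one hr₀ hq, h.pd_one_pd_one_comp_two hr₀ hq] at m
    rw [h2.Dr_Dr_comp_merid hr₀ hq, h2.Dz_Dz_comp_merid hr₀ hq, h2.Dz_comp_merid hr₀ hq,
      hp.Dz_comp_merid hr₀ hq]
    rw [← h2.Dr_comp_merid hr₀ hq] at m
    linear_combination m
  · have m := h.incompressible (merid q) (hS q hq)
    simp only [Fin.sum_univ_three, h.pd_one_comp_one hr₀ hq] at m
    rw [h0.Dr_comp_merid hr₀ hq, h2.Dz_comp_merid hr₀ hq]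
    linear_combination m

end AxisymNoSwirlNSSlab

/-- Integration of an axisymmetric function in cylindrical coordinates. -/
lemma lintegral_cylindrical {Φ : ℝ × ℝ → ENNReal} (hΦ : Measurable Φ) :
    ∫⁻ x : E3, Φ (rr x, x 2) =
      ∫⁻ q in Ioi (0 : ℝ) ×ˢ (univ : Set ℝ), ENNReal.ofReal (2 * π) *
        (ENNReal.ofReal q.1 * Φ q) := by
  have hmeas : Measurable fun w : ℝ × (Fin 2 → ℝ) => Φ (√((w.2 0) ^ 2 + (w.2 1) ^ 2), w.1) :=
    hΦ.comp (by fun_prop)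
  have h1 := (PiLp.volume_preserving_ofLp (Fin 3)).lintegral_comp
    (f := fun y => Φ (√((y 0) ^ 2 + (y 1) ^ 2), y 2)) (hΦ.comp (by fun_prop))
  have h2 := (volume_preserving_piFinSuccAbove (fun _ : Fin 3 => ℝ) 2).lintegral_comp hmeas
  have h3 (z : ℝ) := (volume_preserving_finTwoArrow ℝ).lintegral_comp
    (f := fun w : ℝ × ℝ => Φ (√(w.1 ^ 2 + w.2 ^ 2), z)) (hΦ.comp (by fun_prop))
  have h4 (z : ℝ) : ∫⁻ w : ℝ × ℝ, Φ (√(w.1 ^ 2 + w.2 ^ 2), z) =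
      ∫⁻ r in Ioi (0 : ℝ), ENNReal.ofReal (2 * π) * (ENNReal.ofReal r * Φ (r, z)) := by
    have hm : Measurable fun w : ℝ × ℝ => ENNReal.ofReal w.1 * Φ (w.1, z) :=
      (ENNReal.measurable_ofReal.comp measurable_fst).mul (hΦ.comp (by fun_prop))
    rw [← lintegral_comp_polarCoord_symm, polarCoord_target]
    calc _ = ∫⁻ w in Ioi (0 : ℝ) ×ˢ Ioo (-π) π, ENNReal.ofReal w.1 * Φ (w.1, z) := by
          refine setLIntegral_congr_fun (measurableSet_Ioi.prod measurableSet_Ioo) fun w hw => ?_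
          have hw0 : (0 : ℝ) < w.1 := hw.1
          have e : √((w.1 * cos w.2) ^ 2 + (w.1 * sin w.2) ^ 2) = w.1 := by
            rw [mul_pow, mul_pow, ← mul_add, cos_sq_add_sin_sq, mul_one, sqrt_sq hw0.le]
          simp only [polarCoord_symm_apply, e, smul_eq_mul]
      _ = _ := by
          rw [Measure.volume_eq_prod, setLIntegral_prod _ hm.aemeasurable]
          refine lintegral_congr fun r => ?_
          simp only
          rw [setLIntegral_const, volume_Ioo, mul_comm, sub_neg_eq_add, ← two_mul]
  calc ∫⁻ x : E3, Φ (rr x, x 2) = ∫⁻ y : Fin 3 → ℝ, Φ (√((y 0) ^ 2 + (y 1) ^ 2), y 2) := h1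
    _ = ∫⁻ w : ℝ × (Fin 2 → ℝ), Φ (√((w.2 0) ^ 2 + (w.2 1) ^ 2), w.1) := h2
    _ = ∫⁻ z, ∫⁻ y : Fin 2 → ℝ, Φ (√((y 0) ^ 2 + (y 1) ^ 2), z) := by
        rw [Measure.volume_eq_prod, lintegral_prod _ hmeas.aemeasurable]
    _ = ∫⁻ z, ∫⁻ r in Ioi (0 : ℝ), ENNReal.ofReal (2 * π) * (ENNReal.ofReal r * Φ (r, z)) :=
        lintegral_congr fun z => (h3 z).trans (h4 z)
    _ = _ := by
        rw [Measure.volume_eq_prod, ← Measure.prod_restrict, Measure.restrict_univ,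
          lintegral_prod_symm]
        exact (((ENNReal.measurable_ofReal.comp measurable_fst).mul hΦ).const_mul _).aemeasurable

namespace AxisymNoSwirlNSSlab

variable {r₀ : ℝ} {v : E3 → E3} {p : E3 → ℝ} {vr vz : ℝ → ℝ → ℝ}

lemma meridional_gradient_le (h : AxisymNoSwirlNSSlab r₀ v p vr vz) (hr₀ : 0 < r₀) {x : E3}
    (hx : r₀ < rr x) :
    Dr (fun q => v (merid q) 0) (rr x, x 2) ^ 2 + Dz (fun q => v (merid q) 0) (rr x, x 2) ^ 2 +
      Dr (fun q => v (merid q) 2) (rr x, x 2) ^ 2 ≤ gradSq3 v x := by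
  have hU := (h.smooth_comp 0).comp_merid hr₀
  have hW := (h.smooth_comp 2).comp_merid hr₀
  have hρ := hr₀.trans hx
  have hρ0 := hρ.ne'
  set ρ := rr x with hρdef
  set c := x 0 / ρ with hc
  set s := x 1 / ρ with hs
  have hcs : c ^ 2 + s ^ 2 = 1 := by
    rw [hc, hs, div_pow, div_pow, ← add_div, ← rr_sq, ← hρdef, div_self (pow_ne_zero 2 hρ0)]
  have hx0 : x 0 = c * ρ := by rw [hc]; field_simp
  have hx1 : x 1 = s * ρ := by rw [hs]; field_simp
  set w : E3 := c • basisVec 0 + s • basisVec 1 with hw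
  have hpd : ∀ j, fderiv ℝ (fun y => v y j) x w =
      c * pd 0 (fun y => v y j) x + s * pd 1 (fun y => v y j) x := fun j => by
    simp [hw, pd]
  have hrad : ∀ t : ℝ, 0 < ρ + t → rr (x + t • w) = ρ + t := fun t ht => by
    have : (x 0 + t * c) ^ 2 + (x 1 + t * s) ^ 2 = (ρ + t) ^ 2 := by
      rw [hx0, hx1]; linear_combination (ρ + t) ^ 2 * hcs
    simp [rr, hw, this, sqrt_sq ht.le]
  have hev : ∀ᶠ t in 𝓝 (0 : ℝ), r₀ < ρ + t :=
    (continuous_const.add continuous_id).tendsto' _ _ (by simp [hρdef])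
      |>.eventually (lt_mem_nhds hx)
  have hline : ∀ᶠ t in 𝓝 (0 : ℝ), v (x + t • w) 0 = v (merid (ρ + t, x 2)) 0 * c ∧
      v (x + t • w) 1 = v (merid (ρ + t, x 2)) 0 * s ∧
      v (x + t • w) 2 = v (merid (ρ + t, x 2)) 2 := by
    filter_upwards [hev] with t ht
    have ht0 : 0 < ρ + t := hr₀.trans ht
    have e := h.eq_merid hr₀ (x := x + t • w) (by rwa [hrad t ht0])
    have e0 : (x + t • w) 0 / (ρ + t) = c := by
      rw [div_eq_iff ht0.ne']; simp [hw, hx0]; ring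
    have e1 : (x + t • w) 1 / (ρ + t) = s := by
      rw [div_eq_iff ht0.ne']; simp [hw, hx1]; ring
    have e2 : (x + t • w) 2 = x 2 := by simp [hw]
    rwa [hrad t ht0, e0, e1, e2] at e
  have hvert : ∀ t : ℝ, v (x + t • basisVec 2) 0 = v (merid (ρ, x 2 + t)) 0 * c ∧
      v (x + t • basisVec 2) 1 = v (merid (ρ, x 2 + t)) 0 * s := fun t => by
    have er : rr (x + t • basisVec 2) = ρ := by simp [rr, hρdef]
    have e := h.eq_merid hr₀ (x := x + t • basisVec 2) (by rwa [er])
    rw [er] at e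
    simpa [hc, hs] using And.intro e.1 e.2.1
  have hd : ∀ (j : Fin 3) (u : E3),
      HasDerivAt (fun t : ℝ => v (x + t • u) j) (fderiv ℝ (fun y => v y j) x u) 0 := fun j u => by
    simpa using (h.smooth_comp j).hasDerivAt_line (x := x) (t := 0) u (by simpa using hx)
  have dr_line : ∀ {f : ℝ × ℝ → ℝ}, SmoothHalf r₀ f →
      HasDerivAt (fun t => f (ρ + t, x 2)) (Dr f (ρ, x 2)) 0 := fun {f} hf => by
    have := hf.hasDerivAt_dr (r := ρ + 0) (by simpa using hx) (x 2)
    simpa using this.comp_const_add ρ 0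
  have dz_line : HasDerivAt (fun t => v (merid (ρ, x 2 + t)) 0)
      (Dz (fun q => v (merid q) 0) (ρ, x 2)) 0 := by
    have := hU.hasDerivAt_dz hx (x 2 + 0)
    simpa using this.comp_const_add (x 2) 0
  have a0 := (hd 0 w).unique (((dr_line hU).mul_const c).congr_of_eventuallyEq
    (hline.mono fun t ht => ht.1))
  have a1 := (hd 1 w).unique (((dr_line hU).mul_const s).congr_of_eventuallyEq
    (hline.mono fun t ht => ht.2.1))
  have a2 := (hd 2 w).unique ((dr_line hW).congr_of_eventuallyEq
    (hline.mono fun t ht => ht.2.2))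
  have b0 := (hd 0 (basisVec 2)).unique ((dz_line.mul_const c).congr_of_eventuallyEq
    (Eventually.of_forall fun t => (hvert t).1))
  have b1 := (hd 1 (basisVec 2)).unique ((dz_line.mul_const s).congr_of_eventuallyEq
    (Eventually.of_forall fun t => (hvert t).2))
  rw [hpd] at a0 a1 a2
  change pd 2 (fun y => v y 0) x = _ at b0
  change pd 2 (fun y => v y 1) x = _ at b1
  have cauchy : ∀ α β : ℝ, (c * α + s * β) ^ 2 ≤ α ^ 2 + β ^ 2 := fun α β => by
    have : α ^ 2 + β ^ 2 = (c * α + s * β) ^ 2 + (s * α - c * β) ^ 2 := by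
      linear_combination -(α ^ 2 + β ^ 2) * hcs
    nlinarith [sq_nonneg (s * α - c * β)]
  have k0 := cauchy (pd 0 (fun y => v y 0) x) (pd 1 (fun y => v y 0) x)
  have k1 := cauchy (pd 0 (fun y => v y 1) x) (pd 1 (fun y => v y 1) x)
  have k2 := cauchy (pd 0 (fun y => v y 2) x) (pd 1 (fun y => v y 2) x)
  rw [a0] at k0
  rw [a1] at k1
  rw [a2] at k2
  simp only [gradSq3, Fin.sum_univ_three, b0, b1]
  have := sq_nonneg (pd 2 (fun y => v y 2) x)
  linear_combination k0 + k1 + k2 + this - (Dr (fun q => v (merid q) 0) (ρ, x 2) ^ 2 +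
    Dz (fun q => v (merid q) 0) (ρ, x 2) ^ 2) * hcs

lemma exists_dirichlet_bound (h : AxisymNoSwirlNSSlab r₀ v p vr vz) (hr₀ : 0 < r₀)
    (hdiri : ∫⁻ x : E3 in {x : E3 | r₀ < rr x ∧ x 2 ∈ Icc (-π) π},
      ENNReal.ofReal (gradSq3 v x) < ⊤) {r₁ : ℝ} (hr₁ : r₀ < r₁) :
    ∃ D, ∀ R ≥ r₁, ∫ s in r₁..R, s * zInt (fun q => Dr (fun q => v (merid q) 0) q ^ 2 +
      Dz (fun q => v (merid q) 0) q ^ 2 + Dr (fun q => v (merid q) 2) q ^ 2) s ≤ D := by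
  have hU := (h.smooth_comp 0).comp_merid hr₀
  have hW := (h.smooth_comp 2).comp_merid hr₀
  have hle := fun x (hx : r₀ < rr x) => h.meridional_gradient_le hr₀ hx
  set G : ℝ × ℝ → ℝ := fun q => Dr (fun q => v (merid q) 0) q ^ 2 +
    Dz (fun q => v (merid q) 0) q ^ 2 + Dr (fun q => v (merid q) 2) q ^ 2 with hG
  have hGs : SmoothHalf r₀ G := ((hU.dr.pow 2).add (hU.dz.pow 2)).add (hW.dr.pow 2)
  have hG0 : ∀ q, 0 ≤ G q := fun q => by simp only [hG]; positivity
  have hGm : Measurable G := (((measurable_fderiv_apply_const ℝ _ _).pow_const 2).add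
    ((measurable_fderiv_apply_const ℝ _ _).pow_const 2)).add
    ((measurable_fderiv_apply_const ℝ _ _).pow_const 2)
  refine ⟨(∫⁻ x : E3 in {x : E3 | r₀ < rr x ∧ x 2 ∈ Icc (-π) π},
    ENNReal.ofReal (gradSq3 v x)).toReal, fun R hR => ?_⟩
  set A : Set (ℝ × ℝ) := Ioc r₁ R ×ˢ Ioc (-π) π with hA
  have hAm : MeasurableSet A := measurableSet_Ioc.prod measurableSet_Ioc
  have hpos : ∀ q ∈ A, 0 < q.1 := fun q hq => hr₀.trans (hr₁.trans hq.1.1)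
  have hint : IntegrableOn (fun q : ℝ × ℝ => q.1 * G q) A := by
    have hc : ContinuousOn (fun q : ℝ × ℝ => q.1 * G q) (Icc r₁ R ×ˢ Icc (-π) π) :=
      (ContDiffOn.continuousOn (SmoothHalf.fst.mul hGs)).mono fun q hq => hr₁.trans_le hq.1.1
    exact (hc.integrableOn_compact (isCompact_Icc.prod isCompact_Icc)).mono_set
      (prod_mono Ioc_subset_Icc_self Ioc_subset_Icc_self)
  have e1 : ∫ s in r₁..R, s * zInt G s = ∫ q in A, q.1 * G q := by
    rw [Measure.volume_eq_prod, hA, setIntegral_prod _ hint, intervalIntegral.integral_of_le hR]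
    refine setIntegral_congr_fun measurableSet_Ioc fun s _ => ?_
    simp only
    rw [integral_const_mul, zInt, intervalIntegral.integral_of_le (by linarith [pi_pos])]
  have hlint : ∫⁻ q in A, ENNReal.ofReal (q.1 * G q) ≤
      ∫⁻ x : E3 in {x : E3 | r₀ < rr x ∧ x 2 ∈ Icc (-π) π}, ENNReal.ofReal (gradSq3 v x) := by
    have hcyl := lintegral_cylindrical
      ((ENNReal.measurable_ofReal.comp hGm).indicator hAm)
    have hSm : MeasurableSet {x : E3 | r₀ < rr x ∧ x 2 ∈ Icc (-π) π} :=
      (isOpen_lt_rr r₀).measurableSet.inter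
        ((by fun_prop : Measurable fun x : E3 => x 2) measurableSet_Icc)
    calc ∫⁻ q in A, ENNReal.ofReal (q.1 * G q)
        ≤ ∫⁻ q in Ioi (0 : ℝ) ×ˢ (univ : Set ℝ), ENNReal.ofReal (2 * π) *
          (ENNReal.ofReal q.1 * A.indicator (ENNReal.ofReal ∘ G) q) := by
          rw [← lintegral_indicator hAm,
            ← lintegral_indicator (measurableSet_Ioi.prod MeasurableSet.univ)]
          refine lintegral_mono fun q => ?_
          by_cases hq : q ∈ A
          · have hq' : q ∈ Ioi (0 : ℝ) ×ˢ (univ : Set ℝ) := ⟨hpos q hq, mem_univ _⟩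
            rw [indicator_of_mem hq, indicator_of_mem hq', indicator_of_mem hq,
              ENNReal.ofReal_mul (hpos q hq).le]
            exact le_mul_of_one_le_left' (by
              rw [← ENNReal.ofReal_one]
              exact ENNReal.ofReal_le_ofReal (by linarith [two_le_pi]))
          · simp [hq]
      _ = ∫⁻ x : E3, A.indicator (ENNReal.ofReal ∘ G) (rr x, x 2) := hcyl.symm
      _ ≤ _ := by
          rw [← lintegral_indicator hSm]
          refine lintegral_mono fun x => ?_
          by_cases hx : (rr x, x 2) ∈ A
          · have hx' : r₀ < rr x := hr₁.trans hx.1.1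
            rw [indicator_of_mem hx, indicator_of_mem
              (show x ∈ {x : E3 | r₀ < rr x ∧ x 2 ∈ Icc (-π) π} from
                ⟨hx', Ioc_subset_Icc_self hx.2⟩)]
            exact ENNReal.ofReal_le_ofReal (hle x hx')
          · simp [hx]
  rw [e1, integral_eq_lintegral_of_nonneg_ae ?_ hint.aestronglyMeasurable]
  · exact ENNReal.toReal_mono hdiri.ne hlint
  · filter_upwards [ae_restrict_mem hAm] with q hq
    exact mul_nonneg (hpos q hq).le (hG0 q)

lemma om_eq_vort (h : AxisymNoSwirlNSSlab r₀ v p vr vz) (hr₀ : 0 < r₀) {r : ℝ} (hr : r₀ < r)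
    (z : ℝ) :
    Om vr vz r z = vort (fun q => v (merid q) 0) (fun q => v (merid q) 2) (r, z) := by
  have hU := (h.smooth_comp 0).comp_merid hr₀
  have hW := (h.smooth_comp 2).comp_merid hr₀
  have e1 : dzz vr r z = Dz (fun q => v (merid q) 0) (r, z) := by
    rw [← (hU.hasDerivAt_dz hr z).deriv, dzz]
    exact congrArg (deriv · z) (funext fun t => (h.merid_comp_zero hr₀ (q := (r, t)) hr).symm)
  have e2 : dr vz r z = Dr (fun q => v (merid q) 2) (r, z) := by
    rw [← (hW.hasDerivAt_dr hr z).deriv, dr]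
    refine EventuallyEq.deriv_eq ?_
    filter_upwards [Ioi_mem_nhds hr] with s hs
    exact (h.merid_comp_two hr₀ (q := (s, z)) hs).symm
  rw [Om, omTheta, e1, e2, vort]

end AxisymNoSwirlNSSlab

/-- decay of `Ω` in Theorem 1.1 for `q = 2`:
`r^{3/2} sup_z |Ω(r,z)| → 0` as `r → ∞`. -/
theorem Omega_decay_q_eq_two (r₀ : ℝ) (hr₀ : 0 < r₀)
    (v : E3 → E3) (p : E3 → ℝ) (vr vz : ℝ → ℝ → ℝ)
    (hsol : AxisymNoSwirlNSSlab r₀ v p vr vz)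
    (hdiri : ∫⁻ x : E3 in {x : E3 | r₀ < rr x ∧ x 2 ∈ Icc (-π) π},
      ENNReal.ofReal (gradSq3 v x) < ⊤) :
    Tendsto
      (fun r : ℝ => r ^ ((3 : ℝ) / 2) *
        ⨆ z : (Icc (-π) π : Set ℝ), |Om vr vz r (z : ℝ)|)
      atTop (𝓝 0) := by
  have hr₁ : r₀ < r₀ + 1 := lt_add_one r₀
  obtain ⟨D, hD⟩ := hsol.exists_dirichlet_bound hr₀ hdiri hr₁
  obtain ⟨K, R₀, hK⟩ := (hsol.meridionalNS hr₀).exists_abs_vort_le hr₁ hD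
  have hlim : Tendsto (fun r : ℝ => K * r ^ (-((1 : ℝ) / 2))) atTop (𝓝 0) := by
    simpa using (tendsto_rpow_neg_atTop (by norm_num : (0 : ℝ) < 1 / 2)).const_mul K
  have hne : Nonempty (Icc (-π) π : Set ℝ) := ⟨⟨0, by constructor <;> linarith [pi_pos]⟩⟩
  refine tendsto_of_tendsto_of_tendsto_of_le_of_le' tendsto_const_nhds hlim ?_ ?_
  · filter_upwards [eventually_ge_atTop 0] with r hr
    exact mul_nonneg (rpow_nonneg hr _) (Real.iSup_nonneg fun _ => abs_nonneg _)
  · filter_upwards [eventually_gt_atTop r₀, eventually_ge_atTop R₀] with r hr hr'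
    have hr0 : 0 < r := hr₀.trans hr
    calc r ^ ((3 : ℝ) / 2) * ⨆ z : (Icc (-π) π : Set ℝ), |Om vr vz r (z : ℝ)|
        ≤ r ^ ((3 : ℝ) / 2) * (K / r ^ 2) := by
          gcongr
          exact ciSup_le fun z => by rw [hsol.om_eq_vort hr₀ hr]; exact hK r hr' z
      _ = K * r ^ (-((1 : ℝ) / 2)) := by
          rw [show (-((1 : ℝ) / 2)) = 3 / 2 - 2 by norm_num, rpow_sub hr0, rpow_two]
          ring
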